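/- Let G be a subcubic graph and L a 10-edge list assignment. If G has no strong L-edge-coloring but every proper subgraph of G has a strong edge coloring from (the restriction of) L, then G is cubic (every vertex has degree exactly 3). -/

import Mathlib

/-- Two distinct edges of `G` conflict (are at distance at most 2) if they share an
endpoint or are joined by a common edge. -/
def edgeConflict {V : Type*} (G : SimpleGraph V) (e f : Sym2 V) : Prop :=
  e ≠ f ∧ ((∃ v, v ∈ e ∧ v ∈ f) ∨
    ∃ g ∈ G.edgeSet, (∃ v, v ∈ e ∧ v ∈ g) ∧ (∃ v, v ∈ g ∧ v ∈ f))

/-- `φ` is a strong edge coloring of `G`: edges at distance at most 2 get distinct colors. -/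
def IsStrongEdgeColoring {V : Type*} (G : SimpleGraph V) (φ : Sym2 V → ℕ) : Prop :=
  ∀ e ∈ G.edgeSet, ∀ f ∈ G.edgeSet, edgeConflict G e f → φ e ≠ φ f

/-- `φ` is a strong edge coloring of `G` from the lists `L`. -/
def IsStrongListColoring {V : Type*} (G : SimpleGraph V) (L : Sym2 V → Finset ℕ)
    (φ : Sym2 V → ℕ) : Prop :=
  IsStrongEdgeColoring G φ ∧ ∀ e ∈ G.edgeSet, φ e ∈ L e

/-- `G` is strongly `k`-edge choosable. -/
def StronglyEdgeChoosable {V : Type*} (G : SimpleGraph V) (k : ℕ) : Prop :=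
  ∀ L : Sym2 V → Finset ℕ, (∀ e ∈ G.edgeSet, k ≤ (L e).card) →
    ∃ φ, IsStrongListColoring G L φ

/-- The coefficient of the monomial with exponents `a` in `∏ (x_u - x_v)`, over `(u, v)` in `E`. -/
noncomputable def edgeCoeff : List (ℕ × ℕ) → (ℕ → ℕ) → ℤ
  | [], a => open Classical in if a = 0 then 1 else 0
  | p :: E, a =>
    (if 0 < a p.1 then edgeCoeff E (Function.update a p.1 (a p.1 - 1)) else 0) -
      (if 0 < a p.2 then edgeCoeff E (Function.update a p.2 (a p.2 - 1)) else 0)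

/-- The number of pairs of `E` in which `w` occurs. -/
def occ (w : ℕ) (E : List (ℕ × ℕ)) : ℕ := E.countP fun p => p.1 == w || p.2 == w

theorem edgeCoeff_eq_zero_of_occ_lt {w : ℕ} :
    ∀ {E : List (ℕ × ℕ)} {a : ℕ → ℕ}, occ w E < a w → edgeCoeff E a = 0
  | [], a, h => by
    have : a ≠ 0 := by rintro rfl; simp at h
    simp [edgeCoeff, this]
  | p :: E, a, h => by
    have key : ∀ u, (u = p.1 ∨ u = p.2) →
        (if 0 < a u then edgeCoeff E (Function.update a u (a u - 1)) else 0) = 0 := by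
      intro u hu
      split_ifs with h0
      · apply edgeCoeff_eq_zero_of_occ_lt (w := w)
        by_cases huw : u = w
        · subst huw
          have : occ u (p :: E) = occ u E + 1 := by
            unfold occ
            rw [List.countP_cons_of_pos]
            rcases hu with rfl | rfl <;> simp
          simp
          omega
        · have : occ w E ≤ occ w (p :: E) := by
            unfold occ
            rw [List.countP_cons]
            omega
          rw [Function.update_of_ne (Ne.symm huw)]
          omega
      · rfl
    rw [edgeCoeff, key _ (Or.inl rfl), key _ (Or.inr rfl), sub_zero]

section Nullstellensatz

open MvPolynomial

theorem coeff_prod_X_sub_X (m : ℕ) (E : List (ℕ × ℕ)) (hE : ∀ p ∈ E, p.1 < m ∧ p.2 < m)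
    (x : ℕ → MvPolynomial (Fin m) ℤ) (hx : ∀ i (h : i < m), x i = X ⟨i, h⟩) (a : ℕ → ℕ)
    (ha : ∀ i, m ≤ i → a i = 0) :
    coeff (Finsupp.equivFunOnFinite.symm fun i : Fin m => a i)
      (E.map fun p => x p.1 - x p.2).prod = edgeCoeff E a := by
  induction E generalizing a with
  | nil =>
    simp only [List.map_nil, List.prod_nil, coeff_one, edgeCoeff]
    congr 1
    rw [eq_iff_iff]
    constructor
    · intro h
      funext i
      rcases lt_or_ge i m with hi | hi
      · have := DFunLike.congr_fun h ⟨i, hi⟩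
        simpa using this.symm
      · exact ha i hi
    · rintro rfl
      ext i
      simp
  | cons p E ih =>
    have key : ∀ u, u < m →
        coeff (Finsupp.equivFunOnFinite.symm fun i : Fin m => a i)
          (x u * (E.map fun p => x p.1 - x p.2).prod) =
        if 0 < a u then edgeCoeff E (Function.update a u (a u - 1)) else 0 := by
      intro u hu
      rw [hx u hu, coeff_X_mul']
      by_cases h0 : 0 < a u
      · rw [if_pos (by simp; omega), if_pos h0,
          ← ih (fun q hq => hE q (List.mem_cons_of_mem _ hq))]
        · congr 1
          ext i
          by_cases hi : (i : ℕ) = u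
          · have : (⟨u, hu⟩ : Fin m) = i := Fin.ext hi.symm
            simp [hi, this]
          · have : (⟨u, hu⟩ : Fin m) ≠ i := fun h => hi (by rw [← h])
            simp [hi, Finsupp.single_eq_of_ne this.symm]
        · intro i hi
          rw [Function.update_of_ne (by omega)]
          exact ha i hi
      · rw [if_neg (by simp; omega), if_neg h0]
    have hp := hE p (List.mem_cons_self ..)
    rw [List.map_cons, List.prod_cons, sub_mul, coeff_sub, key _ hp.1, key _ hp.2, edgeCoeff]

/-- The Alon–Tarsi form of the combinatorial Nullstellensatz. -/
theorem exists_list_coloring_of_edgeCoeff_ne_zero {E : List (ℕ × ℕ)} {a : ℕ → ℕ}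
    (h : edgeCoeff E a ≠ 0) (M : ℕ → Finset ℕ) (hM : ∀ i, a i < (M i).card) :
    ∃ s : ℕ → ℕ, (∀ i, s i ∈ M i) ∧ ∀ p ∈ E, s p.1 ≠ s p.2 := by
  classical
  obtain ⟨m, hm⟩ : ∃ m, ∀ p ∈ E, p.1 < m ∧ p.2 < m := by
    clear h hM
    induction E with
    | nil => exact ⟨0, by simp⟩
    | cons p E ih =>
      obtain ⟨m, hm⟩ := ih
      refine ⟨max m (max p.1 p.2 + 1), ?_⟩
      intro q hq
      rcases List.mem_cons.1 hq with rfl | hq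
      · omega
      · have := hm q hq
        omega
  have ha : ∀ i, m ≤ i → a i = 0 := by
    intro i hi
    by_contra hne
    apply h
    apply edgeCoeff_eq_zero_of_occ_lt (w := i)
    have : occ i E = 0 := by
      unfold occ
      rw [List.countP_eq_zero]
      intro p hp
      have := hm p hp
      simp
      omega
    omega
  let x : ℕ → MvPolynomial (Fin m) ℤ := fun i => if h : i < m then X ⟨i, h⟩ else 0
  have hx : ∀ i (h : i < m), x i = X ⟨i, h⟩ := fun i h => dif_pos h
  let f := (E.map fun p => x p.1 - x p.2).prod
  let t : Fin m →₀ ℕ := Finsupp.equivFunOnFinite.symm fun i : Fin m => a i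
  have hc : coeff t f ≠ 0 := by
    rw [coeff_prod_X_sub_X m E hm x hx a ha]
    exact h
  have hhom : ∀ E : List (ℕ × ℕ), (∀ p ∈ E, p.1 < m ∧ p.2 < m) →
      ((E.map fun p => x p.1 - x p.2).prod).IsHomogeneous E.length := by
    intro E
    induction E with
    | nil => intro _; simpa using isHomogeneous_one (Fin m) ℤ
    | cons p E ih =>
      intro hE
      have hp := hE p (List.mem_cons_self ..)
      rw [List.map_cons, List.prod_cons, List.length_cons, add_comm]
      refine IsHomogeneous.mul ?_ (ih fun q hq => hE q (List.mem_cons_of_mem _ hq))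
      rw [hx _ hp.1, hx _ hp.2]
      exact (isHomogeneous_X ℤ _).sub (isHomogeneous_X ℤ _)
  have hdeg : f.totalDegree = t.degree := by
    have hne : f ≠ 0 := by
      intro h0
      rw [h0] at hc
      simp at hc
    rw [(hhom E hm).totalDegree hne]
    by_contra hd
    exact hc ((hhom E hm).coeff_eq_zero (fun h => hd h.symm))
  obtain ⟨s, hs, hev⟩ := combinatorial_nullstellensatz_exists_eval_nonzero f t hc hdeg
    (fun i : Fin m => (M i.1).image (Nat.cast : ℕ → ℤ)) (by
      intro i
      rw [Finset.card_image_of_injective _ Nat.cast_injective]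
      exact hM i)
  have hne : ∀ i, ∃ n, n ∈ M i := fun i => Finset.card_pos.1 (lt_of_le_of_lt (Nat.zero_le _) (hM i))
  choose d hd using hne
  refine ⟨fun i => if h : i < m then (s ⟨i, h⟩).toNat else d i, ?_, ?_⟩
  · intro i
    by_cases hi : i < m
    · obtain ⟨n, hn, hn'⟩ := Finset.mem_image.1 (hs ⟨i, hi⟩)
      simp only [hi, dif_pos, ← hn']
      simpa using hn
    · simp only [hi, dif_neg, not_false_eq_true]
      exact hd i
  · intro p hp heq
    apply hev
    have hpm := hm p hp
    simp only [hpm, dif_pos] at heq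
    have hz : (eval s) (x p.1 - x p.2) = 0 := by
      rw [hx _ hpm.1, hx _ hpm.2]
      simp only [map_sub, eval_X]
      obtain ⟨n, hn, hn'⟩ := Finset.mem_image.1 (hs ⟨p.1, hpm.1⟩)
      obtain ⟨n', hn2, hn2'⟩ := Finset.mem_image.1 (hs ⟨p.2, hpm.2⟩)
      rw [← hn', ← hn2'] at heq ⊢
      simp at heq
      simp [heq]
    rw [map_list_prod]
    apply List.prod_eq_zero
    rw [List.map_map, List.mem_map]
    exact ⟨p, hp, hz⟩

end Nullstellensatz

/-- The `j`-th base-16 digit of `k`. -/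
def digit (k j : ℕ) : ℕ := k / 16 ^ j % 16

theorem digit_lt (k j : ℕ) : digit k j < 16 := Nat.mod_lt _ (by norm_num)

theorem digit_sub_pow {k u : ℕ} (h : 0 < digit k u) (j : ℕ) :
    digit (k - 16 ^ u) j = if j = u then digit k j - 1 else digit k j := by
  unfold digit at *
  obtain ⟨q, hq⟩ : ∃ q, k / 16 ^ u = q := ⟨_, rfl⟩
  have hpos : 0 < 16 ^ u := by positivity
  have hk := Nat.div_add_mod k (16 ^ u)
  have hq1 : 1 ≤ q := by
    rw [hq] at h
    by_contra hc
    have : q = 0 := by omega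
    simp [this] at h
  obtain ⟨q', rfl⟩ : ∃ q', q = q' + 1 := ⟨q - 1, by omega⟩
  rw [hq] at h hk
  have hr := Nat.mod_lt k hpos
  set r := k % 16 ^ u
  have hk' : k - 16 ^ u = 16 ^ u * q' + r := by
    rw [← hk, mul_add]
    omega
  rw [hk']
  rcases lt_trichotomy j u with hj | hj | hj
  · rw [if_neg hj.ne, ← hk]
    obtain ⟨d, rfl⟩ : ∃ d, u = j + (d + 1) := ⟨u - j - 1, by omega⟩
    have e1 : ∀ q, (16 ^ (j + (d + 1)) * q + r) / 16 ^ j % 16 = r / 16 ^ j % 16 := by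
      intro q
      have : 16 ^ (j + (d + 1)) * q + r = r + 16 ^ j * (16 * (16 ^ d * q)) := by ring
      rw [this, Nat.add_mul_div_left _ _ (by positivity), Nat.add_mul_mod_self_left]
    rw [e1, e1]
  · subst hj
    rw [if_pos rfl, ← hk]
    have e1 : ∀ q, (16 ^ j * q + r) / 16 ^ j = q := by
      intro q
      rw [Nat.mul_add_div hpos, Nat.div_eq_of_lt hr, add_zero]
    rw [e1, e1]
    omega
  · rw [if_neg hj.ne', ← hk]
    obtain ⟨d, rfl⟩ : ∃ d, j = u + (1 + d) := ⟨j - u - 1, by omega⟩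
    rw [pow_add, pow_add, pow_one, ← Nat.div_div_eq_div_mul, ← Nat.div_div_eq_div_mul,
      ← Nat.div_div_eq_div_mul, ← Nat.div_div_eq_div_mul]
    have e1 : ∀ q, (16 ^ u * q + r) / 16 ^ u = q := by
      intro q
      rw [Nat.mul_add_div hpos, Nat.div_eq_of_lt hr, add_zero]
    rw [e1, e1]
    have : q' / 16 = (q' + 1) / 16 := by omega
    rw [this]

/-- The union of two linear combinations of packed monomials. -/
def mergeInto (x : ℕ × ℤ) (f : List (ℕ × ℤ) → List (ℕ × ℤ)) : List (ℕ × ℤ) → List (ℕ × ℤ)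
  | [] => x :: f []
  | y :: t =>
    if x.1 < y.1 then x :: f (y :: t)
    else if x.1 = y.1 then (if x.2 + y.2 = 0 then f t else (x.1, x.2 + y.2) :: f t)
    else y :: mergeInto x f t

/-- The sum of two linear combinations of packed monomials. -/
def mergeTerms : List (ℕ × ℤ) → List (ℕ × ℤ) → List (ℕ × ℤ)
  | [] => fun l => l
  | x :: l => mergeInto x (mergeTerms l)

/-- The terms of `l` whose exponent at `u` is positive, lowered by one there, dropping
those exceeding the bounds `bu` and `bv` at `u` and `v`. -/
def lowerTerms (u v bu bv : ℕ) (l : List (ℕ × ℤ)) : List (ℕ × ℤ) :=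
  (l.filter fun x => Nat.blt 0 (digit x.1 u) && Nat.ble (digit x.1 u) (bu + 1) &&
    Nat.ble (digit x.1 v) bv).map fun x => (x.1 - 16 ^ u, x.2)

/-- An upper bound for the useful exponents at `w`. -/
def digitBound (closed : ℕ → Bool) (E : List (ℕ × ℕ)) (w : ℕ) : ℕ :=
  if closed w then occ w E else 15

/-- Expands the product over `E` one factor at a time, dropping vanishing terms. -/
def expandTerms (closed : ℕ → Bool) : List (ℕ × ℕ) → List (ℕ × ℤ) → List (ℕ × ℤ)
  | [], l => l
  | p :: E, l =>
    expandTerms closed E (mergeTerms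
      (lowerTerms p.1 p.2 (digitBound closed E p.1) (digitBound closed E p.2) l)
      ((lowerTerms p.2 p.1 (digitBound closed E p.2) (digitBound closed E p.1) l).map
        fun x => (x.1, -x.2)))

/-- Overwrites `a` at `ρ 0, …, ρ 17` by the base-16 digits of `k`. -/
noncomputable def overwrite (ρ : ℕ → ℕ) (a : ℕ → ℕ) (k w : ℕ) : ℕ :=
  open Classical in if h : ∃ j < 18, ρ j = w then digit k h.choose else a w

/-- The value of a linear combination of coefficients. -/
noncomputable def termsValue (ρ a : ℕ → ℕ) (E : List (ℕ × ℕ)) (l : List (ℕ × ℤ)) : ℤ :=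
  (l.map fun x => x.2 * edgeCoeff E (overwrite ρ a x.1)).sum

theorem overwrite_apply {ρ a : ℕ → ℕ} (hρ : Set.InjOn ρ (Set.Iio 18)) {k j : ℕ} (hj : j < 18) :
    overwrite ρ a k (ρ j) = digit k j := by
  have h : ∃ i < 18, ρ i = ρ j := ⟨j, hj, rfl⟩
  rw [overwrite, dif_pos h, hρ h.choose_spec.1 hj h.choose_spec.2]

theorem update_overwrite {ρ a : ℕ → ℕ} (hρ : Set.InjOn ρ (Set.Iio 18)) {k u : ℕ} (hu : u < 18)
    (h : 0 < digit k u) :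
    Function.update (overwrite ρ a k) (ρ u) (overwrite ρ a k (ρ u) - 1) =
      overwrite ρ a (k - 16 ^ u) := by
  funext w
  by_cases hw : ∃ j < 18, ρ j = w
  · obtain ⟨j, hj, rfl⟩ := hw
    by_cases hju : j = u
    · subst hju
      rw [Function.update_self, overwrite_apply hρ hj, overwrite_apply hρ hj, digit_sub_pow h,
        if_pos rfl]
    · rw [Function.update_of_ne (fun e => hju (hρ hj hu e)), overwrite_apply hρ hj,
        overwrite_apply hρ hj, digit_sub_pow h, if_neg hju]
  · rw [Function.update_of_ne (fun e => hw ⟨u, hu, e.symm⟩), overwrite, overwrite, dif_neg hw,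
      dif_neg hw]

theorem termsValue_mergeTerms (ρ a : ℕ → ℕ) (E : List (ℕ × ℕ)) (l l' : List (ℕ × ℤ)) :
    termsValue ρ a E (mergeTerms l l') = termsValue ρ a E l + termsValue ρ a E l' := by
  induction l generalizing l' with
  | nil => simp [termsValue, mergeTerms]
  | cons x l ih =>
    rw [mergeTerms]
    have hcons : ∀ (z : ℕ × ℤ) m, termsValue ρ a E (z :: m) =
        z.2 * edgeCoeff E (overwrite ρ a z.1) + termsValue ρ a E m := by
      intro z m
      simp [termsValue]
    induction l' with
    | nil => simp only [mergeInto, hcons, ih, add_assoc]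
    | cons y t iht =>
      rw [mergeInto]
      split_ifs with h1 h2 h3
      · simp only [hcons, ih, add_assoc]
      · rw [ih, hcons, hcons, h2]
        have : x.2 = -y.2 := by omega
        rw [this]
        ring
      · rw [hcons, ih, hcons, hcons, ← h2]
        ring
      · rw [hcons, iht, hcons y]
        ring

theorem edgeCoeff_overwrite_eq_zero {ρ a : ℕ → ℕ} (hρ : Set.InjOn ρ (Set.Iio 18))
    {closed : ℕ → Bool} {E E' : List (ℕ × ℕ)} (hE : ∀ p ∈ E, p.1 < 18 ∧ p.2 < 18)
    (hE' : ∀ w < 18, closed w → occ (ρ w) E' = 0) {k w : ℕ} (hw : w < 18)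
    (h : digitBound closed E w < digit k w) :
    edgeCoeff (E.map (Prod.map ρ ρ) ++ E') (overwrite ρ a k) = 0 := by
  apply edgeCoeff_eq_zero_of_occ_lt (w := ρ w)
  rw [overwrite_apply hρ hw]
  unfold digitBound at h
  split_ifs at h with hc
  · refine lt_of_le_of_lt (le_of_eq ?_) h
    have := hE' w hw hc
    unfold occ at *
    rw [List.countP_append, this, add_zero, List.countP_map]
    apply List.countP_congr
    intro p hp
    have h1 : ρ p.1 = ρ w ↔ p.1 = w := hρ.eq_iff (hE p hp).1 hw
    have h2 : ρ p.2 = ρ w ↔ p.2 = w := hρ.eq_iff (hE p hp).2 hw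
    simp [h1, h2]
  · have := digit_lt k w
    omega

theorem termsValue_lowerTerms {ρ a : ℕ → ℕ} (hρ : Set.InjOn ρ (Set.Iio 18))
    {closed : ℕ → Bool} {E E' : List (ℕ × ℕ)} (hE : ∀ p ∈ E, p.1 < 18 ∧ p.2 < 18)
    (hE' : ∀ w < 18, closed w → occ (ρ w) E' = 0) {u v : ℕ} (hu : u < 18) (hv : v < 18)
    (huv : u ≠ v) (l : List (ℕ × ℤ)) :
    termsValue ρ a (E.map (Prod.map ρ ρ) ++ E')
        (lowerTerms u v (digitBound closed E u) (digitBound closed E v) l) =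
      (l.map fun x => x.2 * if 0 < overwrite ρ a x.1 (ρ u) then
        edgeCoeff (E.map (Prod.map ρ ρ) ++ E') (Function.update (overwrite ρ a x.1) (ρ u)
          (overwrite ρ a x.1 (ρ u) - 1)) else 0).sum := by
  induction l with
  | nil => simp [termsValue, lowerTerms]
  | cons x l ih =>
    rw [List.map_cons, List.sum_cons, ← ih]
    have hx := overwrite_apply (a := a) hρ (k := x.1) hu
    by_cases h0 : 0 < digit x.1 u
    · rw [hx, if_pos h0, ← hx, update_overwrite hρ hu h0]
      by_cases h1 : digit x.1 u ≤ digitBound closed E u + 1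
      · by_cases h2 : digit x.1 v ≤ digitBound closed E v
        · simp [lowerTerms, termsValue, h0, h1, h2]
        · rw [edgeCoeff_overwrite_eq_zero hρ hE hE' hv]
          · simp [lowerTerms, h2]
          · rw [digit_sub_pow h0, if_neg huv.symm]
            omega
      · rw [edgeCoeff_overwrite_eq_zero hρ hE hE' hu]
        · simp [lowerTerms, h1]
        · rw [digit_sub_pow h0, if_pos rfl]
          omega
    · rw [hx, if_neg h0]
      simp [lowerTerms, h0]

theorem termsValue_expandTerms {ρ a : ℕ → ℕ} (hρ : Set.InjOn ρ (Set.Iio 18))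
    {closed : ℕ → Bool} {E E' : List (ℕ × ℕ)}
    (hE : ∀ p ∈ E, p.1 < 18 ∧ p.2 < 18 ∧ p.1 ≠ p.2)
    (hE' : ∀ w < 18, closed w → occ (ρ w) E' = 0) (l : List (ℕ × ℤ)) :
    termsValue ρ a E' (expandTerms closed E l) =
      termsValue ρ a (E.map (Prod.map ρ ρ) ++ E') l := by
  induction E generalizing l with
  | nil => rfl
  | cons p E ih =>
    have hp := hE p (List.mem_cons_self ..)
    have hE1 : ∀ p ∈ E, p.1 < 18 ∧ p.2 < 18 ∧ p.1 ≠ p.2 :=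
      fun q hq => hE q (List.mem_cons_of_mem _ hq)
    have hE2 : ∀ p ∈ E, p.1 < 18 ∧ p.2 < 18 := fun q hq => ⟨(hE1 q hq).1, (hE1 q hq).2.1⟩
    have hneg : ∀ m, termsValue ρ a (E.map (Prod.map ρ ρ) ++ E')
        (m.map fun x => (x.1, -x.2)) = -termsValue ρ a (E.map (Prod.map ρ ρ) ++ E') m := by
      intro m
      induction m with
      | nil => simp [termsValue]
      | cons y m ih =>
        simp only [termsValue, List.map_cons, List.sum_cons] at ih ⊢
        rw [ih]
        ring
    rw [expandTerms, ih hE1, termsValue_mergeTerms, hneg,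
      termsValue_lowerTerms hρ hE2 hE' hp.1 hp.2.1 hp.2.2,
      termsValue_lowerTerms hρ hE2 hE' hp.2.1 hp.1 hp.2.2.symm]
    clear hneg
    induction l with
    | nil => simp [termsValue]
    | cons y m ihm =>
      simp only [termsValue, List.map_cons, List.sum_cons, List.cons_append, edgeCoeff,
        Prod.map_fst, Prod.map_snd] at ihm ⊢
      rw [← ihm]
      ring

/-- Whether the coefficient at the packed exponents `k` is found to be nonzero. -/
def certifies (E : List (ℕ × ℕ)) (k : ℕ) : Bool :=
  (E.all fun p => Nat.blt p.1 18 && Nat.blt p.2 18 && !(p.1 == p.2)) &&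
    match expandTerms (fun _ => true) E [(k, 1)] with
    | [(0, z)] => !(z == 0)
    | _ => false

theorem edgeCoeff_ne_zero_of_certifies {E : List (ℕ × ℕ)} {k : ℕ} (h : certifies E k) :
    edgeCoeff E (overwrite id 0 k) ≠ 0 := by
  rw [certifies, Bool.and_eq_true] at h
  obtain ⟨h1, h2⟩ := h
  have hid : Set.InjOn id (Set.Iio 18) := Function.injective_id.injOn
  have hval := termsValue_expandTerms (a := 0) hid (closed := fun _ => true) (E := E) (E' := [])
    (by simpa [and_assoc] using h1) (by simp [occ]) [(k, 1)]
  have hE : E.map (Prod.map id id) ++ [] = E := by simp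
  rw [hE] at hval
  have hr : termsValue id 0 E [(k, 1)] = edgeCoeff E (overwrite id 0 k) := by simp [termsValue]
  rw [← hr, ← hval]
  split at h2
  · rename_i z hz
    rw [hz]
    have h0 : overwrite id 0 0 = 0 := by
      funext w
      by_cases hw : w < 18
      · have := overwrite_apply (a := 0) (k := 0) hid hw
        simpa [digit] using this
      · rw [overwrite, dif_neg (by rintro ⟨j, hj, rfl⟩; exact hw hj)]
    simpa [termsValue, edgeCoeff, h0] using h2
  · simp at h2

open Finset in
/-- The number of neighbors outside `X` of a vertex outside `X` of a cubic graph, `0` on `X`. -/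
def outerDegree {V : Type*} [Fintype V] [DecidableEq V] (G : SimpleGraph V)
    [DecidableRel G.Adj] (X : Finset V) (z : V) : ℕ :=
  if z ∈ X then 0 else 3 - #(G.neighborFinset z ∩ X)

/-- A bound on the number of edges avoiding `X` which conflict with `xy`, where `x ∈ X`. -/
def outerConflicts {V : Type*} [Fintype V] [DecidableEq V] (G : SimpleGraph V)
    [DecidableRel G.Adj] (X : Finset V) (x y : V) : ℕ :=
  ∑ z ∈ (G.neighborFinset x).erase y, outerDegree G X z +
    ∑ z ∈ (G.neighborFinset y).erase x, outerDegree G X z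

theorem edgeConflict.symm {V : Type*} {G : SimpleGraph V} {e f : Sym2 V}
    (h : edgeConflict G e f) : edgeConflict G f e := by
  obtain ⟨hne, h⟩ := h
  refine ⟨hne.symm, ?_⟩
  rcases h with ⟨v, h1, h2⟩ | ⟨g, hg, ⟨v, h1, h2⟩, ⟨w, h3, h4⟩⟩
  · exact Or.inl ⟨v, h2, h1⟩
  · exact Or.inr ⟨g, hg, ⟨w, h4, h3⟩, ⟨v, h2, h1⟩⟩

section

variable {V : Type*} [Fintype V] [DecidableEq V] {G : SimpleGraph V} [DecidableRel G.Adj]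

open Finset

theorem exists_finset_outerConflicts (hsub : ∀ v, G.degree v ≤ 3) {X : Finset V} {x y : V}
    (hx : x ∈ X) (hxy : G.Adj x y) :
    ∃ F : Finset (Sym2 V), #F ≤ outerConflicts G X x y ∧
      ∀ f ∈ G.edgeSet, (∀ v ∈ f, v ∉ X) → edgeConflict G s(x, y) f → f ∈ F := by
  let star : V → Finset (Sym2 V) := fun z =>
    if z ∈ X then ∅ else (G.neighborFinset z \ X).image fun w => s(z, w)
  have hstar : ∀ z, #(star z) ≤ outerDegree G X z := by
    intro z
    simp only [star, outerDegree]
    split_ifs with hz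
    · simp
    · refine card_image_le.trans ?_
      have h1 := card_sdiff_add_card_inter (G.neighborFinset z) X
      have h2 := hsub z
      rw [← G.card_neighborFinset_eq_degree] at h2
      omega
  have hmem : ∀ z w, G.Adj z w → z ∉ X → w ∉ X → s(z, w) ∈ star z := by
    intro z w hzw hz hw
    simp only [star, if_neg hz]
    exact mem_image_of_mem _ (by simp [hzw, hw])
  refine ⟨((G.neighborFinset x).erase y).biUnion star ∪
    ((G.neighborFinset y).erase x).biUnion star, ?_, ?_⟩
  · refine (card_union_le _ _).trans (Nat.add_le_add ?_ ?_) <;>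
      exact card_biUnion_le.trans (sum_le_sum fun z _ => hstar z)
  · intro f hf hfX hconf
    have mem_of : ∀ z w, f = s(z, w) → z ≠ x → z ≠ y → (G.Adj x z ∨ G.Adj y z) →
        f ∈ ((G.neighborFinset x).erase y).biUnion star ∪
          ((G.neighborFinset y).erase x).biUnion star := by
      rintro z w rfl hzx hzy h
      have hst := hmem z w hf (hfX z (by simp)) (hfX w (by simp))
      rw [mem_union, mem_biUnion, mem_biUnion]
      rcases h with h | h
      · exact Or.inl ⟨z, by simp [hzy, h], hst⟩
      · exact Or.inr ⟨z, by simp [hzx, h], hst⟩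
    have of_mem_y : y ∈ f → f ∈ ((G.neighborFinset x).erase y).biUnion star ∪
          ((G.neighborFinset y).erase x).biUnion star := by
      intro hy
      obtain ⟨w, rfl⟩ := Sym2.mem_iff_exists.1 hy
      have hyw : G.Adj y w := hf
      refine mem_of w y Sym2.eq_swap ?_ hyw.ne' (Or.inr hyw)
      rintro rfl
      exact hfX w (by simp) hx
    by_cases hy : y ∈ f
    · exact of_mem_y hy
    rcases hconf.2 with ⟨v, hv, hvf⟩ | ⟨g, hg, ⟨v, hv, hvg⟩, ⟨w, hwg, hwf⟩⟩
    · rcases Sym2.mem_iff.1 hv with rfl | rfl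
      · exact absurd hx (hfX _ hvf)
      · exact of_mem_y hvf
    · have hwx : w ≠ x := by
        rintro rfl
        exact hfX _ hwf hx
      have hwy : w ≠ y := by
        rintro rfl
        exact hy hwf
      have hvw : v ≠ w := by
        rintro rfl
        rcases Sym2.mem_iff.1 hv with h | h
        · exact hwx h
        · exact hwy h
      have hadj : G.Adj v w := by
        rw [← G.mem_edgeSet, ← (Sym2.mem_and_mem_iff hvw).1 ⟨hvg, hwg⟩]
        exact hg
      obtain ⟨u, rfl⟩ := Sym2.mem_iff_exists.1 hwf
      refine mem_of w u rfl hwx hwy ?_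
      rcases Sym2.mem_iff.1 hv with rfl | rfl
      · exact Or.inl hadj
      · exact Or.inr hadj

/-- Colorings of all proper subgraphs extend to the edges at `X` if some coefficient of the
conflict polynomial with small enough exponents does not vanish. -/
theorem exists_coloring_of_edgeCoeff_ne_zero (hsub : ∀ v, G.degree v ≤ 3)
    {L : Sym2 V → Finset ℕ} (hL : ∀ e ∈ G.edgeSet, 10 ≤ #(L e))
    (hmin : ∀ H : SimpleGraph V, H ≤ G → H ≠ G → ∃ φ, IsStrongListColoring H L φ)
    {X : Finset V} {m : ℕ} (hm : 0 < m) {x y : ℕ → V} (hx : ∀ i < m, x i ∈ X)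
    (hxy : ∀ i < m, G.Adj (x i) (y i))
    (hcov : ∀ v ∈ X, ∀ w, G.Adj v w → ∃ i < m, s(x i, y i) = s(v, w))
    {E : List (ℕ × ℕ)} {b : ℕ → ℕ} (hc : edgeCoeff E b ≠ 0)
    (hb : ∀ i < m, b i + outerConflicts G X (x i) (y i) < 10)
    (hconf : ∀ i < m, ∀ j < m, edgeConflict G s(x i, y i) s(x j, y j) → (i, j) ∈ E ∨ (j, i) ∈ E) :
    ∃ φ, IsStrongListColoring G L φ := by
  let H : SimpleGraph V :=
    { Adj := fun a b => G.Adj a b ∧ a ∉ X ∧ b ∉ X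
      symm := ⟨fun a b h => ⟨h.1.symm, h.2.2, h.2.1⟩⟩
      loopless := ⟨fun a h => h.1.ne rfl⟩ }
  have hHG : H ≤ G := fun a b h => h.1
  have hHne : H ≠ G := by
    intro h
    have h0 : H.Adj (x 0) (y 0) := by
      rw [h]
      exact hxy 0 hm
    exact h0.2.1 (hx 0 hm)
  obtain ⟨φ, hφ, hφL⟩ := hmin H hHG hHne
  have hHmem : ∀ f : Sym2 V, f ∈ H.edgeSet ↔ f ∈ G.edgeSet ∧ ∀ v ∈ f, v ∉ X := by
    intro f
    induction f with
    | h a b => simp [H]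
  have hHconf : ∀ e f, (∀ v ∈ e, v ∉ X) → (∀ v ∈ f, v ∉ X) → edgeConflict G e f →
      edgeConflict H e f := by
    rintro e f he hf ⟨hne, h⟩
    by_cases hs : ∃ v, v ∈ e ∧ v ∈ f
    · exact ⟨hne, Or.inl hs⟩
    · obtain ⟨g, hg, ⟨v, hve, hvg⟩, ⟨w, hwg, hwf⟩⟩ := h.resolve_left hs
      have hvw : v ≠ w := by
        rintro rfl
        exact hs ⟨v, hve, hwf⟩
      have hgs := (Sym2.mem_and_mem_iff hvw).1 ⟨hvg, hwg⟩
      refine ⟨hne, Or.inr ⟨g, (hHmem g).2 ⟨hg, ?_⟩, ⟨v, hve, hvg⟩, ⟨w, hwg, hwf⟩⟩⟩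
      intro u hu
      rw [hgs] at hu
      rcases Sym2.mem_iff.1 hu with rfl | rfl
      · exact he _ hve
      · exact hf _ hwf
  have hF : ∀ i, ∃ F : Finset (Sym2 V), i < m → #F ≤ outerConflicts G X (x i) (y i) ∧
      ∀ f ∈ G.edgeSet, (∀ v ∈ f, v ∉ X) → edgeConflict G s(x i, y i) f → f ∈ F := by
    intro i
    by_cases hi : i < m
    · obtain ⟨F, hF⟩ := exists_finset_outerConflicts hsub (hx i hi) (hxy i hi)
      exact ⟨F, fun _ => hF⟩
    · exact ⟨∅, fun h => absurd h hi⟩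
  choose F hF using hF
  let M : ℕ → Finset ℕ := fun i =>
    if i < m then L s(x i, y i) \ (F i).image φ else Finset.range (b i + 1)
  have hM : ∀ i, b i < #(M i) := by
    intro i
    simp only [M]
    split_ifs with hi
    · have h1 := le_card_sdiff ((F i).image φ) (L s(x i, y i))
      have h2 := hL s(x i, y i) (hxy i hi)
      have h3 : #((F i).image φ) ≤ #(F i) := card_image_le
      have h4 := (hF i hi).1
      have h5 := hb i hi
      omega
    · simp
  obtain ⟨s, hs, hsE⟩ := exists_list_coloring_of_edgeCoeff_ne_zero hc M hM
  have hidx : ∀ e : Sym2 V, ∃ i, e ∈ G.edgeSet → (∃ v ∈ e, v ∈ X) → i < m ∧ s(x i, y i) = e := by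
    intro e
    by_cases he : e ∈ G.edgeSet ∧ ∃ v ∈ e, v ∈ X
    · obtain ⟨he, v, hv, hvX⟩ := he
      obtain ⟨w, rfl⟩ := Sym2.mem_iff_exists.1 hv
      obtain ⟨i, hi, h⟩ := hcov v hvX w he
      exact ⟨i, fun _ _ => ⟨hi, h⟩⟩
    · exact ⟨0, fun h1 h2 => absurd ⟨h1, h2⟩ he⟩
  choose idx hidx using hidx
  have hmixed : ∀ e ∈ G.edgeSet, ∀ f ∈ G.edgeSet, (∃ v ∈ e, v ∈ X) → (¬ ∃ v ∈ f, v ∈ X) →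
      edgeConflict G e f → s (idx e) ≠ φ f := by
    intro e he f hf heX hfX hcf
    obtain ⟨hi, hie⟩ := hidx e he heX
    have h1 := hs (idx e)
    simp only [M, if_pos hi] at h1
    intro h2
    refine (mem_sdiff.1 h1).2 (mem_image.2 ⟨f, ?_, h2.symm⟩)
    rw [← hie] at hcf
    exact (hF _ hi).2 f hf (fun v hv hvX => hfX ⟨v, hv, hvX⟩) hcf
  classical
  refine ⟨fun e => if ∃ v ∈ e, v ∈ X then s (idx e) else φ e, ?_, ?_⟩
  · intro e he f hf hcf
    dsimp only
    split_ifs with heX hfX hfX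
    · obtain ⟨hi, hie⟩ := hidx e he heX
      obtain ⟨hj, hjf⟩ := hidx f hf hfX
      rw [← hie, ← hjf] at hcf
      rcases hconf _ hi _ hj hcf with h | h
      · exact hsE _ h
      · exact (hsE _ h).symm
    · exact hmixed e he f hf heX hfX hcf
    · exact (hmixed f hf e he hfX heX hcf.symm).symm
    · have he' : ∀ v ∈ e, v ∉ X := fun v hv hvX => heX ⟨v, hv, hvX⟩
      have hf' : ∀ v ∈ f, v ∉ X := fun v hv hvX => hfX ⟨v, hv, hvX⟩
      exact hφ e ((hHmem e).2 ⟨he, he'⟩) f ((hHmem f).2 ⟨hf, hf'⟩) (hHconf e f he' hf' hcf)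
  · intro e he
    dsimp only
    split_ifs with heX
    · obtain ⟨hi, hie⟩ := hidx e he heX
      have h1 := hs (idx e)
      simp only [M, if_pos hi] at h1
      rw [hie] at h1
      exact (mem_sdiff.1 h1).1
    · exact hφL e ((hHmem e).2 ⟨he, fun v hv hvX => heX ⟨v, hv, hvX⟩⟩)

end

/-- The neighbors of the label `i` in the graph with edge list `K`. -/
def labelNbrs (K : List (ℕ × ℕ)) (i : ℕ) : List ℕ :=
  K.filterMap fun p => if p.1 == i then some p.2 else if p.2 == i then some p.1 else none

/-- `outerDegree` for a graph on labels. -/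
def labelOuterDegree (K : List (ℕ × ℕ)) (X : List ℕ) (z : ℕ) : ℕ :=
  if X.contains z then 0 else 3 - ((labelNbrs K z).filter X.contains).length

/-- The sum of the outer degrees of the neighbors of `y` other than `x`, where unknown
neighbors count `3`. -/
def labelOuterSum (K : List (ℕ × ℕ)) (X : List ℕ) (x y : ℕ) : ℕ :=
  (((labelNbrs K y).filter fun z => !(z == x)).map (labelOuterDegree K X)).sum +
    3 * (2 - ((labelNbrs K y).filter fun z => !(z == x)).length)

/-- The edges of `K` at `X`, oriented away from `X`. -/
def edgesAt (K : List (ℕ × ℕ)) (X : List ℕ) : List (ℕ × ℕ) :=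
  K.filterMap fun p =>
    if X.contains p.1 then some p else if X.contains p.2 then some p.swap else none

/-- Whether the edges `e` and `f` of `K` share a vertex or are joined by an edge. -/
def labelConflict (K : List (ℕ × ℕ)) (e f : ℕ × ℕ) : Bool :=
  [e.1, e.2].any fun a => [f.1, f.2].any fun b => a == b || (labelNbrs K a).contains b

/-- The pairs of indices of conflicting edges of `S`. -/
def conflictPairs (K S : List (ℕ × ℕ)) : List (ℕ × ℕ) :=
  (List.range S.length).flatMap fun i =>
    ((List.range S.length).filter fun j =>
      Nat.blt i j && labelConflict K (S.getD i (0, 0)) (S.getD j (0, 0))).map fun j => (i, j)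

/-- Whether `k` certifies that the configuration `K` with core `X` is reducible. -/
def reducibleBy (N : ℕ) (K : List (ℕ × ℕ)) (X : List ℕ) (k : ℕ) : Bool :=
  (K.all fun p => Nat.blt p.1 N && Nat.blt p.2 N) &&
  ((List.range N).all fun i => decide (labelNbrs K i).Nodup) &&
  (X.all fun x => Nat.blt x N && (labelNbrs K x).length == 3) &&
  Nat.blt 0 (edgesAt K X).length &&
  ((List.range (edgesAt K X).length).all fun i =>
    Nat.blt (digit k i +
      (labelOuterSum K X ((edgesAt K X).getD i (0, 0)).2 ((edgesAt K X).getD i (0, 0)).1 +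
        labelOuterSum K X ((edgesAt K X).getD i (0, 0)).1 ((edgesAt K X).getD i (0, 0)).2)) 10) &&
  certifies (conflictPairs K (edgesAt K X)) k

theorem mem_labelNbrs {K : List (ℕ × ℕ)} {i j : ℕ} :
    j ∈ labelNbrs K i ↔ (i, j) ∈ K ∨ (j, i) ∈ K := by
  simp only [labelNbrs, List.mem_filterMap]
  constructor
  · rintro ⟨⟨a, b⟩, h, h'⟩
    simp only [beq_iff_eq] at h'
    split_ifs at h' with h1 h2
    · simp_all
    · simp_all
  · rintro (h | h)
    · exact ⟨_, h, by simp⟩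
    · refine ⟨_, h, ?_⟩
      by_cases hji : j = i <;> simp [hji]

/-- `G` is subcubic and all its proper subgraphs are colorable from `L`, but `G` is not. -/
structure IsCritical {V : Type*} [Fintype V] [DecidableEq V] (G : SimpleGraph V)
    [DecidableRel G.Adj] (L : Sym2 V → Finset ℕ) : Prop where
  degree_le : ∀ v, G.degree v ≤ 3
  card_le : ∀ e ∈ G.edgeSet, 10 ≤ (L e).card
  not_colorable : ¬ ∃ φ, IsStrongListColoring G L φ
  exists_coloring : ∀ H : SimpleGraph V, H ≤ G → H ≠ G → ∃ φ, IsStrongListColoring H L φ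

section

variable {V : Type*} [Fintype V] [DecidableEq V] {G : SimpleGraph V} [DecidableRel G.Adj]

open Finset

theorem outerDegree_le_labelOuterDegree {K : List (ℕ × ℕ)} {X : List ℕ} {N : ℕ} {ψ : ℕ → V}
    (hψ : Set.InjOn ψ (Set.Iio N)) (hK : ∀ p ∈ K, p.1 < N ∧ p.2 < N)
    (hadj : ∀ p ∈ K, G.Adj (ψ p.1) (ψ p.2)) {z : ℕ} (hz : (labelNbrs K z).Nodup) :
    outerDegree G (X.toFinset.image ψ) (ψ z) ≤ labelOuterDegree K X z := by
  unfold outerDegree labelOuterDegree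
  have hlt : ∀ c ∈ labelNbrs K z, c < N := by
    intro c hc
    rcases mem_labelNbrs.1 hc with h | h
    · exact (hK _ h).2
    · exact (hK _ h).1
  by_cases hX : X.contains z
  · rw [if_pos]
    · simp
    · exact mem_image_of_mem _ (by simpa using hX)
  · rw [if_neg (c := X.contains z = true) hX]
    split_ifs
    · simp
    · apply Nat.sub_le_sub_left
      rw [← List.toFinset_card_of_nodup (hz.filter _), ← card_image_of_injOn (f := ψ)]
      · apply card_le_card
        intro w hw
        obtain ⟨c, hc, rfl⟩ := mem_image.1 hw
        rw [List.mem_toFinset, List.mem_filter] at hc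
        rw [mem_inter, G.mem_neighborFinset]
        refine ⟨?_, mem_image_of_mem _ (by simpa using hc.2)⟩
        rcases mem_labelNbrs.1 hc.1 with h | h
        · exact hadj _ h
        · exact (hadj _ h).symm
      · intro c hc d hd h
        refine hψ (hlt c ?_) (hlt d ?_) h
        · simp at hc
          exact hc.1
        · simp at hd
          exact hd.1

theorem sum_outerDegree_le_labelOuterSum (hsub : ∀ v, G.degree v ≤ 3)
    {K : List (ℕ × ℕ)} {X : List ℕ} {N : ℕ} {ψ : ℕ → V}
    (hψ : Set.InjOn ψ (Set.Iio N)) (hK : ∀ p ∈ K, p.1 < N ∧ p.2 < N)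
    (hadj : ∀ p ∈ K, G.Adj (ψ p.1) (ψ p.2)) (hnd : ∀ i < N, (labelNbrs K i).Nodup)
    {x y : ℕ} (hx : x < N) (hy : y < N) (hxy : G.Adj (ψ x) (ψ y)) :
    ∑ z ∈ (G.neighborFinset (ψ y)).erase (ψ x), outerDegree G (X.toFinset.image ψ) z ≤
      labelOuterSum K X x y := by
  unfold labelOuterSum
  set l := (labelNbrs K y).filter fun z => !(z == x) with hl
  have hlnd : l.Nodup := (hnd y hy).filter _
  have hlmem : ∀ c ∈ l, c < N ∧ c ≠ x ∧ G.Adj (ψ y) (ψ c) := by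
    intro c hc
    rw [hl, List.mem_filter] at hc
    refine ⟨?_, by simpa using hc.2, ?_⟩ <;> rcases mem_labelNbrs.1 hc.1 with h | h
    · exact (hK _ h).2
    · exact (hK _ h).1
    · exact hadj _ h
    · exact (hadj _ h).symm
  have hinj : Set.InjOn ψ (l.toFinset : Set ℕ) := by
    intro c hc d hd h
    exact hψ (hlmem c (by simpa using hc)).1 (hlmem d (by simpa using hd)).1 h
  have hsubset : l.toFinset.image ψ ⊆ (G.neighborFinset (ψ y)).erase (ψ x) := by
    intro w hw
    obtain ⟨c, hc, rfl⟩ := mem_image.1 hw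
    have h := hlmem c (by simpa using hc)
    rw [mem_erase, G.mem_neighborFinset]
    exact ⟨fun e => h.2.1 (hψ h.1 hx e), h.2.2⟩
  rw [← sum_sdiff hsubset, add_comm]
  apply Nat.add_le_add
  · rw [sum_image hinj, List.sum_toFinset _ hlnd]
    apply List.sum_le_sum
    intro c hc
    exact outerDegree_le_labelOuterDegree hψ hK hadj (hnd c (hlmem c hc).1)
  · have hcard : #((G.neighborFinset (ψ y)).erase (ψ x) \ l.toFinset.image ψ) ≤ 2 - l.length := by
      rw [card_sdiff_of_subset hsubset, card_image_of_injOn hinj,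
        List.toFinset_card_of_nodup hlnd, card_erase_of_mem (by simpa using hxy.symm),
        G.card_neighborFinset_eq_degree]
      have := hsub (ψ y)
      omega
    have h3 : ∀ z, outerDegree G (X.toFinset.image ψ) z ≤ 3 := by
      intro z
      unfold outerDegree
      split_ifs <;> omega
    refine (sum_le_card_nsmul _ _ 3 fun z _ => h3 z).trans ?_
    rw [smul_eq_mul, mul_comm]
    exact Nat.mul_le_mul_left _ hcard

theorem IsCritical.false_of_reducibleBy {L : Sym2 V → Finset ℕ} (hG : IsCritical G L)
    {N : ℕ} {K : List (ℕ × ℕ)} {X : List ℕ} {k : ℕ} (hred : reducibleBy N K X k)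
    {ψ : ℕ → V} (hψ : Set.InjOn ψ (Set.Iio N)) (hadj : ∀ p ∈ K, G.Adj (ψ p.1) (ψ p.2))
    (hnon : ∀ i < N, ∀ j < N, i ∉ X → j ∉ X → G.Adj (ψ i) (ψ j) → j ∈ labelNbrs K i) :
    False := by
  simp only [reducibleBy, Bool.and_eq_true, List.all_eq_true, List.mem_range,
    decide_eq_true_eq, Nat.blt_eq, beq_iff_eq] at hred
  obtain ⟨⟨⟨⟨⟨hK, hnd⟩, hX⟩, hpos⟩, hb⟩, hcert⟩ := hred
  have hlt : ∀ i, ∀ c ∈ labelNbrs K i, c < N := by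
    intro i c hc
    rcases mem_labelNbrs.1 hc with h | h
    · exact (hK _ h).2
    · exact (hK _ h).1
  have hadj' : ∀ i, ∀ c ∈ labelNbrs K i, G.Adj (ψ i) (ψ c) := by
    intro i c hc
    rcases mem_labelNbrs.1 hc with h | h
    · exact hadj _ h
    · exact (hadj _ h).symm
  have hclosed : ∀ a ∈ X, ∀ w, G.Adj (ψ a) w → ∃ c ∈ labelNbrs K a, ψ c = w := by
    intro a ha w hw
    have hinj : Set.InjOn ψ ((labelNbrs K a).toFinset : Set ℕ) := by
      intro c hc d hd h
      exact hψ (hlt a c (by simpa using hc)) (hlt a d (by simpa using hd)) h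
    have hsubset : (labelNbrs K a).toFinset.image ψ ⊆ G.neighborFinset (ψ a) := by
      intro w hw
      obtain ⟨c, hc, rfl⟩ := mem_image.1 hw
      rw [G.mem_neighborFinset]
      exact hadj' a c (by simpa using hc)
    have heq := eq_of_subset_of_card_le hsubset (by
      rw [card_image_of_injOn hinj, List.toFinset_card_of_nodup (hnd a (hX a ha).1), (hX a ha).2,
        G.card_neighborFinset_eq_degree]
      exact hG.degree_le _)
    have hmem : w ∈ G.neighborFinset (ψ a) := by simpa using hw
    rw [← heq] at hmem
    obtain ⟨c, hc, rfl⟩ := mem_image.1 hmem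
    exact ⟨c, by simpa using hc, rfl⟩
  have hexact : ∀ i < N, ∀ j < N, G.Adj (ψ i) (ψ j) → j ∈ labelNbrs K i := by
    intro i hi j hj h
    by_cases hiX : i ∈ X
    · obtain ⟨c, hc, he⟩ := hclosed i hiX _ h
      rwa [← hψ (hlt i c hc) hj he]
    by_cases hjX : j ∈ X
    · obtain ⟨c, hc, he⟩ := hclosed j hjX _ h.symm
      rw [hψ (hlt j c hc) hi he, mem_labelNbrs] at hc
      exact mem_labelNbrs.2 hc.symm
    · exact hnon i hi j hj hiX hjX h
  set S := edgesAt K X with hS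
  have hSmem : ∀ p ∈ S, p.1 ∈ X ∧ p.2 ∈ labelNbrs K p.1 ∧ p.1 < N ∧ p.2 < N := by
    intro p hp
    rw [hS, edgesAt, List.mem_filterMap] at hp
    obtain ⟨q, hq, hqp⟩ := hp
    split_ifs at hqp with h1 h2
    · obtain rfl := Option.some.inj hqp
      exact ⟨by simpa using h1, mem_labelNbrs.2 (Or.inl hq), hK _ hq⟩
    · obtain rfl := Option.some.inj hqp
      exact ⟨by simpa using h2, mem_labelNbrs.2 (Or.inr hq), (hK _ hq).symm⟩
  have hget : ∀ i < S.length, S.getD i (0, 0) ∈ S := by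
    intro i hi
    rw [List.getD_eq_getElem _ _ hi]
    exact List.getElem_mem hi
  apply hG.not_colorable
  refine exists_coloring_of_edgeCoeff_ne_zero hG.degree_le hG.card_le hG.exists_coloring
    (X := X.toFinset.image ψ) (m := S.length) hpos (x := fun i => ψ (S.getD i (0, 0)).1)
    (y := fun i => ψ (S.getD i (0, 0)).2) ?_ ?_ ?_
    (edgeCoeff_ne_zero_of_certifies hcert) ?_ ?_
  · intro i hi
    exact mem_image_of_mem _ (by simpa using (hSmem _ (hget i hi)).1)
  · intro i hi
    exact hadj' _ _ (hSmem _ (hget i hi)).2.1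
  · intro v hv w hvw
    obtain ⟨a, ha, rfl⟩ := mem_image.1 hv
    rw [List.mem_toFinset] at ha
    obtain ⟨c, hc, rfl⟩ := hclosed a ha w hvw
    have : ∃ p ∈ S, s(ψ p.1, ψ p.2) = s(ψ a, ψ c) := by
      simp only [hS, edgesAt, List.mem_filterMap]
      have hac : (a, c) ∈ K ∨ (c, a) ∈ K := mem_labelNbrs.1 hc
      by_cases hcX : c ∈ X
      · rcases hac with h | h
        · exact ⟨_, ⟨_, h, by simp only [List.contains_iff_mem, if_pos ha]; rfl⟩, rfl⟩
        · exact ⟨_, ⟨_, h, by simp only [List.contains_iff_mem, if_pos hcX]; rfl⟩, Sym2.eq_swap⟩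
      · rcases hac with h | h
        · exact ⟨_, ⟨_, h, by simp only [List.contains_iff_mem, if_pos ha]; rfl⟩, rfl⟩
        · exact ⟨_, ⟨_, h, by
            simp only [List.contains_iff_mem, if_neg hcX, if_pos ha]; rfl⟩, rfl⟩
    obtain ⟨p, hp, he⟩ := this
    obtain ⟨i, hi, rfl⟩ := List.getElem_of_mem hp
    refine ⟨i, hi, ?_⟩
    rw [List.getD_eq_getElem _ _ hi]
    exact he
  · intro i hi
    refine lt_of_le_of_lt ?_ (hb i hi)
    have hmem := hSmem _ (hget i hi)
    apply Nat.add_le_add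
    · by_cases hlt : i < 18
      · exact (overwrite_apply (a := 0) (ρ := id) Function.injective_id.injOn hlt).le
      · rw [overwrite, dif_neg (by rintro ⟨j, hj, rfl⟩; exact hlt hj)]
        exact Nat.zero_le _
    · apply Nat.add_le_add
      · exact sum_outerDegree_le_labelOuterSum hG.degree_le hψ hK hadj hnd hmem.2.2.2 hmem.2.2.1
          (hadj' _ _ hmem.2.1).symm
      · exact sum_outerDegree_le_labelOuterSum hG.degree_le hψ hK hadj hnd hmem.2.2.1 hmem.2.2.2
          (hadj' _ _ hmem.2.1)
  · intro i hi j hj hconf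
    have hpair : ∀ i < S.length, ∀ j < S.length, i < j →
        labelConflict K (S.getD i (0, 0)) (S.getD j (0, 0)) → (i, j) ∈ conflictPairs K S := by
      intro i hi j hj hij h
      simp only [conflictPairs, List.mem_flatMap, List.mem_range, List.mem_map, List.mem_filter,
        Bool.and_eq_true, Nat.blt_eq, Prod.mk.injEq]
      exact ⟨i, hi, j, ⟨hj, hij, h⟩, rfl, rfl⟩
    have hlab : ∀ i < S.length, ∀ j < S.length,
        edgeConflict G s(ψ (S.getD i (0, 0)).1, ψ (S.getD i (0, 0)).2)
          s(ψ (S.getD j (0, 0)).1, ψ (S.getD j (0, 0)).2) →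
        labelConflict K (S.getD i (0, 0)) (S.getD j (0, 0)) := by
      intro i hi j hj ⟨_, h⟩
      have hpi := hSmem _ (hget i hi)
      have hpj := hSmem _ (hget j hj)
      have hends : ∀ p ∈ S, ∀ v, v ∈ s(ψ p.1, ψ p.2) → ∃ a ∈ [p.1, p.2], a < N ∧ ψ a = v := by
        intro p hp v hv
        have := hSmem p hp
        rcases Sym2.mem_iff.1 hv with rfl | rfl
        · exact ⟨_, by simp, this.2.2.1, rfl⟩
        · exact ⟨_, by simp, this.2.2.2, rfl⟩
      simp only [labelConflict, List.any_eq_true, Bool.or_eq_true, beq_iff_eq,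
        List.contains_iff_mem]
      rcases h with ⟨v, h1, h2⟩ | ⟨g, hg, ⟨v, h1, h2⟩, ⟨w, h3, h4⟩⟩
      · obtain ⟨a, ha, haN, rfl⟩ := hends _ (hget i hi) v h1
        obtain ⟨c, hc, hcN, he⟩ := hends _ (hget j hj) _ h2
        exact ⟨a, ha, c, hc, Or.inl (hψ haN hcN he.symm)⟩
      · obtain ⟨a, ha, haN, rfl⟩ := hends _ (hget i hi) v h1
        obtain ⟨c, hc, hcN, rfl⟩ := hends _ (hget j hj) w h4
        refine ⟨a, ha, c, hc, ?_⟩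
        by_cases hac : a = c
        · exact Or.inl hac
        · right
          apply hexact a haN c hcN
          have hne : ψ a ≠ ψ c := fun e => hac (hψ haN hcN e)
          rw [← G.mem_edgeSet, ← (Sym2.mem_and_mem_iff hne).1 ⟨h2, h3⟩]
          exact hg
    rcases lt_trichotomy i j with hij | rfl | hij
    · exact Or.inl (hpair i hi j hj hij (hlab i hi j hj hconf))
    · exact absurd rfl hconf.1
    · exact Or.inr (hpair j hj i hi hij (hlab j hj i hi hconf.symm))

end

/-- All sublists of a list. -/
def allSublists {α : Type*} : List α → List (List α)
  | [] => [[]]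
  | a :: l => allSublists l ++ (allSublists l).map (a :: ·)

theorem filter_mem_allSublists {α : Type*} (q : α → Bool) :
    ∀ l : List α, l.filter q ∈ allSublists l
  | [] => by simp [allSublists]
  | a :: l => by
    have ih := filter_mem_allSublists q l
    rw [allSublists, List.mem_append]
    cases h : q a
    · left
      simpa [h] using ih
    · right
      simpa [h] using ih

/-- Whether some label has degree more than `3` in `K`. -/
def overfull (N : ℕ) (K : List (ℕ × ℕ)) : Bool :=
  (K.all fun p => Nat.blt p.1 N && Nat.blt p.2 N) &&
  (List.range N).any fun i => decide (labelNbrs K i).Nodup && Nat.blt 3 (labelNbrs K i).length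

/-- Whether `certs` certifies the reducibility of the configurations consisting of the edges
`E` and some of the edges `opt`, where the pairs in `non` are not adjacent. -/
def reducibleFamily (N : ℕ) (E : List (ℕ × ℕ)) (X : List ℕ) (opt non : List (ℕ × ℕ))
    (certs : List ℕ) : Bool :=
  ((List.range N).all fun i => (List.range N).all fun j =>
    Nat.ble j i || X.contains i || X.contains j ||
      [E, opt, non].any fun l => l.contains (i, j) || l.contains (j, i)) &&
  (allSublists opt).length == certs.length &&
  ((allSublists opt).zip certs).all fun x =>
    overfull N (E ++ x.1) || reducibleBy N (E ++ x.1) X x.2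

section

variable {V : Type*} [Fintype V] [DecidableEq V] {G : SimpleGraph V} [DecidableRel G.Adj]

open Finset

theorem not_overfull (hsub : ∀ v, G.degree v ≤ 3) {N : ℕ} {K : List (ℕ × ℕ)} {ψ : ℕ → V}
    (hψ : Set.InjOn ψ (Set.Iio N)) (hadj : ∀ p ∈ K, G.Adj (ψ p.1) (ψ p.2)) :
    overfull N K = false := by
  by_contra h
  simp only [Bool.not_eq_false, overfull, Bool.and_eq_true, List.all_eq_true, List.any_eq_true,
    List.mem_range, decide_eq_true_eq, Nat.blt_eq] at h
  obtain ⟨hK, i, hi, hnd, hlen⟩ := h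
  have hlt : ∀ c ∈ labelNbrs K i, c < N ∧ G.Adj (ψ i) (ψ c) := by
    intro c hc
    rcases mem_labelNbrs.1 hc with h | h
    · exact ⟨(hK _ h).2, hadj _ h⟩
    · exact ⟨(hK _ h).1, (hadj _ h).symm⟩
  have hsubset : (labelNbrs K i).toFinset.image ψ ⊆ G.neighborFinset (ψ i) := by
    intro w hw
    obtain ⟨c, hc, rfl⟩ := mem_image.1 hw
    rw [G.mem_neighborFinset]
    exact (hlt c (by simpa using hc)).2
  have hcard := card_le_card hsubset
  rw [card_image_of_injOn, List.toFinset_card_of_nodup hnd,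
    G.card_neighborFinset_eq_degree] at hcard
  · have := hsub (ψ i)
    omega
  · intro c hc d hd h
    exact hψ (hlt c (by simpa using hc)).1 (hlt d (by simpa using hd)).1 h

theorem IsCritical.false_of_reducibleFamily {L : Sym2 V → Finset ℕ} (hG : IsCritical G L)
    {N : ℕ} {E : List (ℕ × ℕ)} {X : List ℕ} {opt non : List (ℕ × ℕ)} {certs : List ℕ}
    (hred : reducibleFamily N E X opt non certs)
    {ψ : ℕ → V} (hψ : Set.InjOn ψ (Set.Iio N)) (hadj : ∀ p ∈ E, G.Adj (ψ p.1) (ψ p.2))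
    (hnon : ∀ p ∈ non, ¬ G.Adj (ψ p.1) (ψ p.2)) : False := by
  simp only [reducibleFamily, Bool.and_eq_true, List.all_eq_true, List.mem_range,
    Nat.ble_eq, beq_iff_eq, Bool.or_eq_true, List.contains_iff_mem] at hred
  obtain ⟨⟨hpairs, hlen⟩, hcert⟩ := hred
  have hmem := filter_mem_allSublists (fun p => decide (G.Adj (ψ p.1) (ψ p.2))) opt
  set Q := opt.filter fun p => decide (G.Adj (ψ p.1) (ψ p.2)) with hQ
  obtain ⟨n, hn, hnQ⟩ := List.getElem_of_mem hmem
  have hz : (Q, certs[n]'(by omega)) ∈ (allSublists opt).zip certs := by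
    rw [← hnQ, ← List.getElem_zip (h := by rw [List.length_zip]; omega)]
    exact List.getElem_mem _
  have hadjQ : ∀ p ∈ E ++ Q, G.Adj (ψ p.1) (ψ p.2) := by
    intro p hp
    rcases List.mem_append.1 hp with h | h
    · exact hadj p h
    · simpa using (List.mem_filter.1 h).2
  rcases hcert _ hz with h | h
  · rw [not_overfull hG.degree_le hψ hadjQ] at h
    exact absurd h (by simp)
  · have key : ∀ i < N, ∀ j < N, i ∉ X → j ∉ X → i < j → G.Adj (ψ i) (ψ j) →
        (i, j) ∈ E ++ Q ∨ (j, i) ∈ E ++ Q := by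
      intro i hi j hj hiX hjX hij hadj
      rcases hpairs i hi j hj with ((h | h) | h) | h
      · omega
      · exact absurd h hiX
      · exact absurd h hjX
      · simp only [List.any_eq_true, List.mem_cons, List.not_mem_nil, or_false, Bool.or_eq_true,
          List.contains_iff_mem] at h
        obtain ⟨l, hl | hl | hl, hl'⟩ := h
        · subst hl
          exact hl'.imp (List.mem_append_left _) (List.mem_append_left _)
        · subst hl
          refine hl'.imp (fun h => List.mem_append_right _ ?_)
            (fun h => List.mem_append_right _ ?_)
          · exact List.mem_filter.2 ⟨h, by simpa using hadj⟩
          · exact List.mem_filter.2 ⟨h, by simpa using hadj.symm⟩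
        · subst hl
          rcases hl' with h | h
          · exact absurd hadj (hnon _ h)
          · exact absurd hadj.symm (hnon _ h)
    apply hG.false_of_reducibleBy h hψ hadjQ
    intro i hi j hj hiX hjX hadj
    rcases lt_trichotomy i j with hij | rfl | hij
    · exact mem_labelNbrs.2 (key i hi j hj hiX hjX hij hadj)
    · exact absurd hadj G.irrefl
    · exact mem_labelNbrs.2 (key j hj i hi hjX hiX hij hadj.symm).symm

theorem IsCritical.false_of_list {L : Sym2 V → Finset ℕ} (hG : IsCritical G L)
    {E : List (ℕ × ℕ)} {X : List ℕ} {opt non : List (ℕ × ℕ)} {certs : List ℕ} {d : V}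
    (N : ℕ) (vs : List V) (hN : vs.length = N) (hvs : vs.Nodup)
    (hred : reducibleFamily N E X opt non certs)
    (hadj : ∀ p ∈ E, G.Adj (vs.getD p.1 d) (vs.getD p.2 d))
    (hnon : ∀ p ∈ non, ¬ G.Adj (vs.getD p.1 d) (vs.getD p.2 d)) : False := by
  subst hN
  refine hG.false_of_reducibleFamily hred (ψ := fun i => vs.getD i d) ?_ hadj hnon
  intro i hi j hj h
  have hi' : i < vs.length := hi
  have hj' : j < vs.length := hj
  simp only [List.getD_eq_getElem _ _ hi', List.getD_eq_getElem _ _ hj'] at h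
  exact (hvs.getElem_inj_iff).1 h

end

section

variable {V : Type*} [Fintype V] [DecidableEq V] {G : SimpleGraph V} [DecidableRel G.Adj]
  {L : Sym2 V → Finset ℕ}

open Finset

theorem IsCritical.degree_eq (hG : IsCritical G L) {v w : V} (h : G.Adj v w) :
    G.degree v = 3 := by
  have hle := hG.degree_le v
  by_contra hne
  apply hG.not_colorable
  have hmemw : w ∈ G.neighborFinset v := by simpa using h
  have houter : ∀ z, outerDegree G {v} z ≤ 3 := by
    intro z
    unfold outerDegree
    split_ifs <;> omega
  have hfar : ∀ z, G.Adj v z →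
      ∑ u ∈ (G.neighborFinset z).erase v, outerDegree G {v} u ≤ 6 := by
    intro z hz
    refine (sum_le_card_nsmul _ _ 3 fun u _ => houter u).trans ?_
    rw [card_erase_of_mem (by simpa using hz.symm), G.card_neighborFinset_eq_degree, smul_eq_mul]
    have := hG.degree_le z
    omega
  have hother : ∀ z, G.Adj v z → outerDegree G {v} z ≤ 2 := by
    intro z hz
    unfold outerDegree
    split_ifs
    · omega
    · have : 0 < #(G.neighborFinset z ∩ {v}) := card_pos.2 ⟨v, by simpa using hz.symm⟩
      omega
  have hcard : #((G.neighborFinset v).erase w) = G.degree v - 1 := by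
    rw [card_erase_of_mem hmemw, G.card_neighborFinset_eq_degree]
  have hpos : 0 < G.degree v := by
    rw [← G.card_neighborFinset_eq_degree]
    exact card_pos.2 ⟨w, hmemw⟩
  by_cases h1 : G.degree v = 1
  · rw [h1, card_eq_zero] at hcard
    refine exists_coloring_of_edgeCoeff_ne_zero hG.degree_le hG.card_le hG.exists_coloring
      (X := {v}) (m := 1) one_pos (x := fun _ => v) (y := fun _ => w) (by simp)
      (by simpa using h) ?_ (E := []) (b := 0) (by simp [edgeCoeff]) ?_ ?_
    · intro a ha z hz
      rw [mem_singleton] at ha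
      subst ha
      refine ⟨0, one_pos, ?_⟩
      by_contra hzw
      have : z ∈ (G.neighborFinset a).erase w := by
        rw [mem_erase, G.mem_neighborFinset]
        exact ⟨fun e => hzw (by rw [e]), hz⟩
      rw [hcard] at this
      simp at this
    · intro i _
      have := hfar w h
      simp only [outerConflicts, hcard, sum_empty, Pi.zero_apply]
      omega
    · intro i _ j _ hij
      exact absurd rfl hij.1
  · have h2 : G.degree v = 2 := by omega
    rw [h2] at hcard
    obtain ⟨w', hw'⟩ := card_eq_one.1 hcard
    have hmem' : w' ∈ (G.neighborFinset v).erase w := by simp [hw']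
    have hvw' : G.Adj v w' := by simpa using mem_of_mem_erase hmem'
    have hww' : w' ≠ w := ne_of_mem_erase hmem'
    have hnbrs : ∀ z, G.Adj v z → z = w ∨ z = w' := by
      intro z hz
      by_contra hzz
      push Not at hzz
      have : z ∈ (G.neighborFinset v).erase w := by simpa [hzz.1] using hz
      rw [hw', mem_singleton] at this
      exact hzz.2 this
    have herase' : (G.neighborFinset v).erase w' = {w} := by
      ext z
      rw [mem_erase, G.mem_neighborFinset, mem_singleton]
      constructor
      · rintro ⟨h1, h2⟩
        exact (hnbrs z h2).resolve_right h1
      · rintro rfl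
        exact ⟨hww'.symm, h⟩
    refine exists_coloring_of_edgeCoeff_ne_zero hG.degree_le hG.card_le hG.exists_coloring
      (X := {v}) (m := 2) two_pos (x := fun _ => v) (y := fun i => if i = 0 then w else w')
      (by simp) ?_ ?_ (E := [(0, 1)]) (b := fun i => if i = 0 then 1 else 0) ?_ ?_ ?_
    · intro i _
      split_ifs
      · exact h
      · exact hvw'
    · intro a ha z hz
      rw [mem_singleton] at ha
      subst ha
      rcases hnbrs z hz with rfl | rfl
      · exact ⟨0, by simp⟩
      · exact ⟨1, by simp⟩
    · have : (Function.update (fun i => if i = 0 then 1 else 0) 0 0 : ℕ → ℕ) = 0 := by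
        funext i
        by_cases hi : i = 0 <;> simp [hi]
      simp [edgeCoeff, this]
    · intro i _
      have a1 := hfar w h
      have a2 := hfar w' hvw'
      have a3 := hother w h
      have a4 := hother w' hvw'
      split_ifs
      · simp only [outerConflicts, hw', sum_singleton]
        omega
      · simp only [outerConflicts, herase', sum_singleton]
        omega
    · intro i hi j hj hij
      have : i ≠ j := by
        rintro rfl
        exact hij.1 rfl
      simp only [List.mem_singleton, Prod.mk.injEq]
      omega

theorem IsCritical.exists_third (hG : IsCritical G L) {v a : V} (ha : G.Adj v a) (b : V) :
    ∃ c, G.Adj v c ∧ c ≠ a ∧ c ≠ b := by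
  have h3 := hG.degree_eq ha
  have : 0 < #(((G.neighborFinset v).erase a).erase b) := by
    have h1 := pred_card_le_card_erase (s := G.neighborFinset v) (a := a)
    have h2 := pred_card_le_card_erase (s := (G.neighborFinset v).erase a) (a := b)
    rw [G.card_neighborFinset_eq_degree] at h1
    omega
  obtain ⟨c, hc⟩ := card_pos.1 this
  simp only [mem_erase, G.mem_neighborFinset] at hc
  exact ⟨c, hc.2.2, hc.2.1, hc.1⟩

theorem IsCritical.no_triangle (hG : IsCritical G L) {a b c : V} (hab : G.Adj a b)
    (hbc : G.Adj b c) (hac : G.Adj a c) : False := by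
  obtain ⟨d, had, hdb, hdc⟩ := hG.exists_third hab c
  obtain ⟨e, hbe, hea, hec⟩ := hG.exists_third hab.symm c
  have h1 := hab.ne
  have h2 := hbc.ne
  have h3 := hac.ne
  have h4 := had.ne
  have h5 := hbe.ne
  by_cases hde : d = e
  · subst hde
    apply hG.false_of_list (d := a) 4 [a, b, c, d] rfl (by simp; tauto)
      (E := [(0, 1), (0, 2), (1, 2), (0, 3), (1, 3)]) (X := [0, 1]) (opt := [(2, 3)]) (non := [])
      (certs := [4660, 4660]) (by decide +kernel)
    · simp; tauto
    · simp
  · apply hG.false_of_list (d := a) 5 [a, b, c, d, e] rfl (by simp; tauto)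
      (E := [(0, 1), (0, 2), (1, 2), (0, 3), (1, 4)]) (X := [0, 1])
      (opt := [(2, 3), (2, 4), (3, 4)]) (non := [])
      (certs := [4675, 4675, 4675, 4675, 4675, 4675, 0, 0]) (by decide +kernel)
    · simp; tauto
    · simp

end

section

variable {V : Type*} [Fintype V] [DecidableEq V] {G : SimpleGraph V} [DecidableRel G.Adj]
  {L : Sym2 V → Finset ℕ}

theorem IsCritical.no_three_common_nbrs (hG : IsCritical G L) {x y a b c : V} (hxy : x ≠ y)
    (hab : a ≠ b) (hac : a ≠ c) (hbc : b ≠ c) (hxa : G.Adj x a) (hxb : G.Adj x b)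
    (hxc : G.Adj x c) (hya : G.Adj y a) (hyb : G.Adj y b) (hyc : G.Adj y c) : False := by
  have tri : ∀ a b c, G.Adj a b → G.Adj b c → ¬ G.Adj a c := fun a b c => hG.no_triangle
  have sym : ∀ a b, G.Adj a b → G.Adj b a := fun a b h => h.symm
  have irr : ∀ a, ¬ G.Adj a a := fun a => G.irrefl
  have two : ∀ a b c p r, a ≠ b → a ≠ c → b ≠ c → G.Adj x a → G.Adj x b → G.Adj x c →
      G.Adj y a → G.Adj y b → G.Adj y c → G.Adj a p → p ≠ x → p ≠ y → G.Adj b p →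
      G.Adj c r → r ≠ x → r ≠ y → p ≠ r → False := by
    intro a b c p r hab hac hbc hxa hxb hxc hya hyb hyc hap hpx hpy hbp hcr hrx hry hpr
    apply hG.false_of_list (d := x) 7 [x, y, a, b, c, p, r] rfl
      (by simp; and_intros <;> intro h <;> subst h <;> grind)
      (E := [(0, 2), (0, 3), (0, 4), (1, 2), (1, 3), (1, 4), (2, 5), (3, 5), (4, 6)])
      (X := [0, 1, 2, 3, 4]) (opt := [(5, 6)]) (non := [])
      (certs := [20207224, 305419896]) (by decide +kernel)
    · simp; tauto
    · simp
  have three : ∀ a b c p q r, a ≠ b → a ≠ c → b ≠ c → G.Adj x a → G.Adj x b → G.Adj x c →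
      G.Adj y a → G.Adj y b → G.Adj y c → G.Adj a p → p ≠ x → p ≠ y → G.Adj b q → q ≠ x →
      q ≠ y → G.Adj c r → r ≠ x → r ≠ y → p ≠ q → p ≠ r → q ≠ r → ¬ G.Adj q r → False := by
    intro a b c p q r hab hac hbc hxa hxb hxc hya hyb hyc hap hpx hpy hbq hqx hqy hcr hrx hry
      hpq hpr hqr hnqr
    apply hG.false_of_list (d := x) 8 [x, y, a, b, c, p, q, r] rfl
      (by simp; and_intros <;> intro h <;> subst h <;> grind)
      (E := [(0, 2), (0, 3), (0, 4), (1, 2), (1, 3), (1, 4), (2, 5), (3, 6), (4, 7)])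
      (X := [0, 1, 2, 3, 4]) (opt := [(5, 6), (5, 7)]) (non := [(6, 7)])
      (certs := [857949543, 874726759, 12954322279, 13977732455]) (by decide +kernel)
    · simp; tauto
    · simpa using hnqr
  obtain ⟨p, hap, hpx, hpy⟩ := hG.exists_third hxa.symm y
  obtain ⟨q, hbq, hqx, hqy⟩ := hG.exists_third hxb.symm y
  obtain ⟨r, hcr, hrx, hry⟩ := hG.exists_third hxc.symm y
  by_cases hpq : p = q
  · subst hpq
    by_cases hpr : p = r
    · subst hpr
      apply hG.false_of_list (d := x) 6 [x, y, a, b, c, p] rfl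
        (by simp; and_intros <;> intro h <;> subst h <;> grind)
        (E := [(0, 2), (0, 3), (0, 4), (1, 2), (1, 3), (1, 4), (2, 5), (3, 5), (4, 5)])
        (X := [0, 1, 2, 3, 4]) (opt := []) (non := [])
        (certs := [305419896]) (by decide +kernel)
      · simp; tauto
      · simp
    · exact two a b c p r hab hac hbc hxa hxb hxc hya hyb hyc hap hpx hpy hbq hcr hrx hry hpr
  by_cases hpr : p = r
  · subst hpr
    exact two a c b p q hac hab hbc.symm hxa hxc hxb hya hyc hyb hap hpx hpy hcr hbq hqx hqy hpq
  by_cases hqr : q = r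
  · subst hqr
    exact two b c a q p hbc hab.symm hac.symm hxb hxc hxa hyb hyc hya hbq hqx hqy hcr hap hpx hpy
      (Ne.symm hpq)
  by_cases hnqr : G.Adj q r
  · by_cases hnpr : G.Adj p r
    · have hnpq : ¬ G.Adj p q := fun h => tri p q r h hnqr hnpr
      exact three c a b r p q hac.symm hbc.symm hab hxc hxa hxb hyc hya hyb hcr hrx hry hap hpx hpy
        hbq hqx hqy (Ne.symm hpr) (Ne.symm hqr) hpq hnpq
    · exact three b a c q p r hab.symm hbc hac hxb hxa hxc hyb hya hyc hbq hqx hqy hap hpx hpy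
        hcr hrx hry (Ne.symm hpq) hqr hpr hnpr
  · exact three a b c p q r hab hac hbc hxa hxb hxc hya hyb hyc hap hpx hpy hbq hqx hqy
      hcr hrx hry hpq hpr hqr hnqr

theorem IsCritical.no_four_cycle_opposite_adj_adjacent (hG : IsCritical G L)
    {v₀ v₁ v₂ v₃ u₀ u₁ u₂ : V} (h01 : G.Adj v₀ v₁) (h12 : G.Adj v₁ v₂) (h23 : G.Adj v₂ v₃)
    (h30 : G.Adj v₃ v₀) (hv02 : v₀ ≠ v₂) (hv13 : v₁ ≠ v₃) (h0 : G.Adj v₀ u₀) (h01' : u₀ ≠ v₁)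
    (h03' : u₀ ≠ v₃) (h1 : G.Adj v₁ u₁) (h10' : u₁ ≠ v₀) (h12' : u₁ ≠ v₂) (h2 : G.Adj v₂ u₂)
    (h21' : u₂ ≠ v₁) (h23' : u₂ ≠ v₃) (hu02 : G.Adj u₀ u₂) : ¬ G.Adj u₀ u₁ := by
  intro hu01
  have tri : ∀ a b c, G.Adj a b → G.Adj b c → ¬ G.Adj a c := fun a b c => hG.no_triangle
  have sym : ∀ a b, G.Adj a b → G.Adj b a := fun a b h => h.symm
  have irr : ∀ a, ¬ G.Adj a a := fun a => G.irrefl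
  apply hG.false_of_list (d := v₀) 7 [v₀, v₁, v₂, u₀, v₃, u₁, u₂] rfl
    (by simp; and_intros <;> intro h <;> subst h <;> grind)
    (E := [(0, 1), (1, 2), (2, 4), (4, 0), (0, 3), (1, 5), (2, 6), (3, 6), (3, 5)])
    (X := [0, 1, 2, 3]) (opt := []) (non := [(4, 5), (4, 6), (5, 6)])
    (certs := [8895354215]) (by decide +kernel)
  · simp; tauto
  · have : ¬ G.Adj v₃ u₁ := fun h => hG.no_three_common_nbrs hv13 hv02 h10'.symm h12'.symm
      h01.symm h12 h1 h30 h23.symm h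
    simp; grind

theorem IsCritical.no_four_cycle_opposite_adj (hG : IsCritical G L)
    {v₀ v₁ v₂ v₃ u₀ u₂ : V} (h01 : G.Adj v₀ v₁) (h12 : G.Adj v₁ v₂) (h23 : G.Adj v₂ v₃)
    (h30 : G.Adj v₃ v₀) (hv02 : v₀ ≠ v₂) (hv13 : v₁ ≠ v₃) (h0 : G.Adj v₀ u₀) (h01' : u₀ ≠ v₁)
    (h03' : u₀ ≠ v₃) (h2 : G.Adj v₂ u₂) (h21' : u₂ ≠ v₁) (h23' : u₂ ≠ v₃) : ¬ G.Adj u₀ u₂ := by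
  intro hu02
  have tri : ∀ a b c, G.Adj a b → G.Adj b c → ¬ G.Adj a c := fun a b c => hG.no_triangle
  have sym : ∀ a b, G.Adj a b → G.Adj b a := fun a b h => h.symm
  have irr : ∀ a, ¬ G.Adj a a := fun a => G.irrefl
  obtain ⟨u₁, h1, h10', h12'⟩ := hG.exists_third h01.symm v₂
  obtain ⟨w, hw, hw0, hw2⟩ := hG.exists_third h0.symm u₂
  have n01 := hG.no_four_cycle_opposite_adj_adjacent h01 h12 h23 h30 hv02 hv13 h0 h01' h03'
    h1 h10' h12' h2 h21' h23' hu02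
  have n21 := hG.no_four_cycle_opposite_adj_adjacent h12.symm h01.symm h30.symm h23.symm hv02.symm
    hv13 h2 h21' h23' h1 h12' h10' h0 h01' h03' hu02.symm
  have n31 : ¬ G.Adj v₃ u₁ := fun h => hG.no_three_common_nbrs hv13 hv02 h10'.symm h12'.symm
      h01.symm h12 h1 h30 h23.symm h
  apply hG.false_of_list (d := v₀) 8 [v₀, v₁, v₂, u₀, v₃, u₁, u₂, w] rfl
    (by simp; and_intros <;> intro h <;> subst h <;> grind)
    (E := [(0, 1), (1, 2), (2, 4), (4, 0), (0, 3), (1, 5), (2, 6), (3, 6), (3, 7)])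
    (X := [0, 1, 2, 3]) (opt := [(4, 7), (5, 7)]) (non := [(4, 5), (4, 6), (5, 6), (6, 7)])
    (certs := [5405623382, 5406671958, 8893265238, 8894313814]) (by decide +kernel)
  · simp; tauto
  · simp; grind

theorem IsCritical.no_four_cycle (hG : IsCritical G L) {v₀ v₁ v₂ v₃ : V} (h01 : G.Adj v₀ v₁)
    (h12 : G.Adj v₁ v₂) (h23 : G.Adj v₂ v₃) (h30 : G.Adj v₃ v₀) (hv02 : v₀ ≠ v₂)
    (hv13 : v₁ ≠ v₃) : False := by
  have tri : ∀ a b c, G.Adj a b → G.Adj b c → ¬ G.Adj a c := fun a b c => hG.no_triangle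
  have sym : ∀ a b, G.Adj a b → G.Adj b a := fun a b h => h.symm
  have irr : ∀ a, ¬ G.Adj a a := fun a => G.irrefl
  obtain ⟨u₀, h0, h01', h03'⟩ := hG.exists_third h01 v₃
  obtain ⟨u₁, h1, h10', h12'⟩ := hG.exists_third h01.symm v₂
  obtain ⟨u₂, h2, h21', h23'⟩ := hG.exists_third h12.symm v₃
  obtain ⟨u₃, h3, h30', h32'⟩ := hG.exists_third h30 v₂
  have n02 := hG.no_four_cycle_opposite_adj h01 h12 h23 h30 hv02 hv13 h0 h01' h03' h2 h21' h23'
  have n13 := hG.no_four_cycle_opposite_adj h12 h23 h30 h01 hv13 hv02.symm h1 h12' h10' h3 h32'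
    h30'
  have hu02 : u₀ ≠ u₂ := by
    rintro rfl
    exact hG.no_three_common_nbrs hv02 hv13 h01'.symm h03'.symm h01 h30.symm h0 h12.symm h23 h2
  have hu13 : u₁ ≠ u₃ := by
    rintro rfl
    exact hG.no_three_common_nbrs hv13 hv02 h10'.symm h12'.symm h01.symm h12 h1 h30 h23.symm h3
  apply hG.false_of_list (d := v₀) 8 [v₀, v₁, v₂, v₃, u₀, u₁, u₂, u₃] rfl
    (by simp; and_intros <;> intro h <;> subst h <;> grind)
    (E := [(0, 1), (1, 2), (2, 3), (3, 0), (0, 4), (1, 5), (2, 6), (3, 7)]) (X := [0, 1, 2, 3])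
    (opt := [(4, 5), (5, 6), (6, 7), (4, 7)]) (non := [(4, 6), (5, 7)])
    (certs := [858989381, 590619461, 607331141, 590619461, 339944261, 323232581,
      339944261, 323232581, 323232581, 306520901, 323232581, 306520901, 55845701,
      39134021, 55845701, 39134021]) (by decide +kernel)
  · simp; tauto
  · simpa using ⟨n02, n13⟩

end

/-- `f 0, …, f (n - 1)` is a cycle of `G`. -/
structure IsCycleMap {V : Type*} (G : SimpleGraph V) (n : ℕ) (f : ℕ → V) : Prop where
  three_le : 3 ≤ n
  injOn : Set.InjOn f (Set.Iio n)
  adj : ∀ i, i + 1 < n → G.Adj (f i) (f (i + 1))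
  adj_last : G.Adj (f (n - 1)) (f 0)

/-- A shortest cycle `v 0, …, v (k - 1)` of length at least `5` in a cubic graph, extended
periodically, with the neighbors `u i` of `v i` outside the cycle. -/
structure IsShortestCycle {V : Type*} (G : SimpleGraph V) (k : ℕ) (v u : ℕ → V) : Prop where
  five_le : 5 ≤ k
  v_eq_iff : ∀ i j, v i = v j ↔ i % k = j % k
  adj : ∀ i, G.Adj (v i) (v (i + 1))
  adj_u : ∀ i, G.Adj (v i) (u i)
  u_ne_v : ∀ i j, u i ≠ v j
  u_eq_iff : ∀ i j, u i = u j ↔ i % k = j % k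
  not_adj_v : ∀ i d, 2 ≤ d → d + 2 ≤ k → ¬ G.Adj (v i) (v (i + d))
  of_adj_u : ∀ i d, 0 < d → d < k → G.Adj (u i) (u (i + d)) → k ≤ d + 3 ∧ d ≤ 3
  eq_of_adj : ∀ i w, G.Adj (v i) w → w = v (i + 1) ∨ w = v (i + k - 1) ∨ w = u i

section

variable {V : Type*} [Fintype V] [DecidableEq V] {G : SimpleGraph V} [DecidableRel G.Adj]
  {L : Sym2 V → Finset ℕ}

open Finset

theorem IsCritical.exists_isCycleMap (hG : IsCritical G L) {a b : V} (hab : G.Adj a b) :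
    ∃ n f, IsCycleMap G n f := by
  have hstep : ∀ p : {p : V × V // G.Adj p.1 p.2}, ∃ q : {p : V × V // G.Adj p.1 p.2},
      q.1.1 = p.1.2 ∧ q.1.2 ≠ p.1.1 := by
    rintro ⟨⟨x, y⟩, h⟩
    obtain ⟨c, hc, hcx, -⟩ := hG.exists_third h.symm x
    exact ⟨⟨(y, c), hc⟩, rfl, hcx⟩
  choose next hnext1 hnext2 using hstep
  let s : ℕ → {p : V × V // G.Adj p.1 p.2} := fun n => next^[n] ⟨(a, b), hab⟩
  have hs : ∀ n, s (n + 1) = next (s n) := fun n => Function.iterate_succ_apply' _ _ _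
  let x : ℕ → V := fun n => (s n).1.1
  have hx : ∀ n, x (n + 1) = (s n).1.2 := fun n => by
    simp only [x, hs]
    exact hnext1 _
  have hadj : ∀ n, G.Adj (x n) (x (n + 1)) := fun n => by
    rw [hx]
    exact (s n).2
  have hne : ∀ n, x (n + 2) ≠ x n := fun n => by
    rw [hx, hs]
    exact hnext2 _
  have hrep : ∃ m, ∃ i, 0 < m ∧ x i = x (i + m) := by
    obtain ⟨i, j, hij, h⟩ := Finite.exists_ne_map_eq_of_infinite x
    rcases lt_or_gt_of_ne hij with hlt | hlt
    · exact ⟨j - i, i, by omega, by rw [Nat.add_sub_of_le hlt.le]; exact h⟩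
    · exact ⟨i - j, j, by omega, by rw [Nat.add_sub_of_le hlt.le]; exact h.symm⟩
  classical
  obtain ⟨i, hpos, heq⟩ := Nat.find_spec hrep
  have hmin := fun m => Nat.find_min hrep (m := m)
  set m := Nat.find hrep
  have h1 : m ≠ 1 := fun h => (hadj i).ne (by rw [heq, h])
  have h2 : m ≠ 2 := fun h => hne i (by rw [heq, h])
  refine ⟨m, fun t => x (i + t), by omega, ?_, fun t _ => hadj _, ?_⟩
  · intro p hp q hq hpq
    simp only [Set.mem_Iio] at hp hq
    by_contra hne'
    rcases lt_or_gt_of_ne hne' with hlt | hlt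
    · refine hmin (q - p) (by omega) ⟨i + p, by omega, ?_⟩
      rw [show i + p + (q - p) = i + q by omega]
      exact hpq
    · refine hmin (p - q) (by omega) ⟨i + q, by omega, ?_⟩
      rw [show i + q + (p - q) = i + p by omega]
      exact hpq.symm
  · have := hadj (i + (m - 1))
    rw [show i + (m - 1) + 1 = i + m by omega, ← heq] at this
    exact this

theorem mod_add_ne {k i d : ℕ} (hd : 0 < d) (hdk : d < k) : (i + d) % k ≠ i % k := by
  intro h
  have := (Nat.modEq_iff_dvd' (Nat.le_add_right i d)).1 (Eq.symm h)
  rw [Nat.add_sub_cancel_left] at this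
  exact absurd (Nat.le_of_dvd hd this) (by omega)

theorem exists_eq_add_of_mod_ne {k i j : ℕ} (hk : 0 < k) (h : i % k ≠ j % k) :
    ∃ d, 0 < d ∧ d < k ∧ (i + d) % k = j % k := by
  have hi := Nat.mod_lt i hk
  have hj := Nat.mod_lt j hk
  rcases lt_or_gt_of_ne h with hlt | hlt
  · refine ⟨j % k - i % k, by omega, by omega, ?_⟩
    rw [Nat.add_mod, Nat.mod_eq_of_lt (a := j % k - i % k) (by omega),
      Nat.add_sub_of_le hlt.le, Nat.mod_mod]
  · refine ⟨j % k + k - i % k, by omega, by omega, ?_⟩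
    rw [Nat.add_mod, Nat.mod_eq_of_lt (a := j % k + k - i % k) (by omega),
      Nat.add_sub_of_le (by omega), Nat.add_mod_right, Nat.mod_mod]

theorem IsCritical.exists_isShortestCycle (hG : IsCritical G L) {a b : V} (hab : G.Adj a b) :
    ∃ k v u, IsShortestCycle G k v u := by
  classical
  have hex := hG.exists_isCycleMap hab
  obtain ⟨f, hf⟩ := Nat.find_spec hex
  have hmin : ∀ m g, IsCycleMap G m g → Nat.find hex ≤ m := fun m g h => Nat.find_min' hex ⟨g, h⟩
  set k := Nat.find hex
  have hk3 := hf.three_le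
  have hfadj := hf.adj
  have hflast := hf.adj_last
  have hk0 : 0 < k := by omega
  have hk5 : 5 ≤ k := by
    by_contra hlt
    have : k = 3 ∨ k = 4 := by omega
    rcases this with h | h
    · rw [h] at hfadj hflast
      exact hG.no_triangle (hfadj 0 (by omega)) (hfadj 1 (by omega)) hflast.symm
    · have h4 := hf.injOn
      rw [h] at hfadj hflast h4
      refine hG.no_four_cycle (hfadj 0 (by omega)) (hfadj 1 (by omega)) (hfadj 2 (by omega))
        hflast (fun h => ?_) (fun h => ?_)
      · exact absurd (h4 (by simp) (by simp) h) (by simp)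
      · exact absurd (h4 (by simp) (by simp) h) (by simp)
  set v : ℕ → V := fun i => f (i % k) with hv
  have v_eq_iff : ∀ i j, v i = v j ↔ i % k = j % k := fun i j =>
    ⟨fun h => hf.injOn (Nat.mod_lt _ hk0) (Nat.mod_lt _ hk0) h, fun h => by simp only [hv, h]⟩
  have adj : ∀ i, G.Adj (v i) (v (i + 1)) := by
    intro i
    have hi := Nat.mod_lt i hk0
    by_cases h : i % k + 1 < k
    · have : (i + 1) % k = i % k + 1 := by
        rw [Nat.add_mod, Nat.mod_eq_of_lt (a := 1) (by omega), Nat.mod_eq_of_lt h]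
      simp only [hv, this]
      exact hfadj _ h
    · have h1 : i % k = k - 1 := by omega
      have : (i + 1) % k = 0 := by
        rw [Nat.add_mod, h1, Nat.mod_eq_of_lt (a := 1) (by omega), Nat.sub_add_cancel (by omega),
          Nat.mod_self]
      simp only [hv, this, h1]
      exact hflast
  have hlast : ∀ i, G.Adj (v i) (v (i + k - 1)) := by
    intro i
    have h := adj (i + k - 1)
    rw [show i + k - 1 + 1 = i + k by omega, (v_eq_iff (i + k) i).2 (by simp)] at h
    exact h.symm
  have arc_inj : ∀ i p q, p < k → q < k → v (i + p) = v (i + q) → p = q := by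
    intro i p q hp hq h
    rw [v_eq_iff] at h
    by_contra hne
    rcases lt_or_gt_of_ne hne with hlt | hlt
    · refine mod_add_ne (k := k) (i := i + p) (d := q - p) (by omega) (by omega) ?_
      rw [h, show i + p + (q - p) = i + q by omega]
    · refine mod_add_ne (k := k) (i := i + q) (d := p - q) (by omega) (by omega) ?_
      rw [← h, show i + q + (p - q) = i + p by omega]
  have not_adj_v : ∀ i d, 2 ≤ d → d + 2 ≤ k → ¬ G.Adj (v i) (v (i + d)) := by
    intro i d hd hdk h
    have := hmin (d + 1) (fun t => v (i + t)) ⟨by omega, fun p hp q hq h => arc_inj i p q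
      (by simp at hp; omega) (by simp at hq; omega) h, fun t _ => adj (i + t), h.symm⟩
    omega
  have one_extra : ∀ i d x, 0 < d → d < k → (∀ j, x ≠ v j) → G.Adj (v i) x →
      G.Adj (v (i + d)) x → k ≤ d + 2 := by
    intro i d x hd hdk hx h1 h2
    refine hmin (d + 2) (fun t => if t ≤ d then v (i + t) else x) ⟨by omega, ?_, ?_, ?_⟩
    · intro p hp q hq h
      simp only [Set.mem_Iio] at hp hq
      simp only at h
      split_ifs at h
      · exact arc_inj i p q (by omega) (by omega) h
      · exact absurd h.symm (hx _)
      · exact absurd h (hx _)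
      · omega
    · intro t ht
      by_cases htd : t + 1 ≤ d
      · simp only [htd, show t ≤ d by omega, if_true]
        exact adj (i + t)
      · obtain rfl : t = d := by omega
        simpa using h2
    · simpa using h1.symm
  have two_extra : ∀ i d x y, 0 < d → d < k → (∀ j, x ≠ v j) → (∀ j, y ≠ v j) → G.Adj (v i) x →
      G.Adj (v (i + d)) y → G.Adj x y → k ≤ d + 3 := by
    intro i d x y hd hdk hx hy h1 h2 hxy
    refine hmin (d + 3) (fun t => if t ≤ d then v (i + t) else if t = d + 1 then y else x)
      ⟨by omega, ?_, ?_, ?_⟩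
    · intro p hp q hq h
      simp only [Set.mem_Iio] at hp hq
      simp only at h
      split_ifs at h
      · exact arc_inj i p q (by omega) (by omega) h
      · exact absurd h.symm (hy _)
      · exact absurd h.symm (hx _)
      · exact absurd h (hy _)
      · omega
      · exact absurd h.symm hxy.ne
      · exact absurd h (hx _)
      · exact absurd h hxy.ne
      · omega
    · intro t ht
      by_cases htd : t + 1 ≤ d
      · simp only [htd, show t ≤ d by omega, if_true]
        exact adj (i + t)
      · by_cases h : t = d
        · subst h
          simpa using h2
        · obtain rfl : t = d + 1 := by omega
          simpa using hxy.symm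
    · simpa using h1.symm
  have hthird : ∀ i, ∃ c, G.Adj (v i) c ∧ c ≠ v (i + 1) ∧ c ≠ v (i + k - 1) := fun i =>
    hG.exists_third (adj i) _
  choose c hc hc1 hc2 using hthird
  have hvmod : ∀ i, v (i % k) = v i := fun i => (v_eq_iff _ _).2 (by simp)
  have hvmod1 : ∀ i, v (i % k + 1) = v (i + 1) := fun i => (v_eq_iff _ _).2 (by simp)
  have hvmod2 : ∀ i, v (i % k + k - 1) = v (i + k - 1) := fun i => (v_eq_iff _ _).2 (by
    rw [Nat.add_sub_assoc (by omega), Nat.add_sub_assoc (by omega)]; simp)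
  obtain ⟨u, hu⟩ : ∃ u : ℕ → V, ∀ i, u i = c (i % k) := ⟨_, fun _ => rfl⟩
  have adj_u : ∀ i, G.Adj (v i) (u i) := fun i => by
    rw [hu, ← hvmod]
    exact hc _
  have u_ne1 : ∀ i, u i ≠ v (i + 1) := fun i => by
    rw [hu, ← hvmod1]
    exact hc1 _
  have u_ne2 : ∀ i, u i ≠ v (i + k - 1) := fun i => by
    rw [hu, ← hvmod2]
    exact hc2 _
  have u_ne_v : ∀ i j, u i ≠ v j := by
    intro i j h
    have hij := adj_u i
    rw [h] at hij
    by_cases heq : i % k = j % k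
    · exact hij.ne ((v_eq_iff _ _).2 heq)
    · obtain ⟨d, hd, hdk, he⟩ := exists_eq_add_of_mod_ne hk0 heq
      rw [← (v_eq_iff _ _).2 he] at h hij
      by_cases h1 : d = 1
      · subst h1
        exact u_ne1 i h
      · by_cases h2 : d = k - 1
        · subst h2
          rw [← Nat.add_sub_assoc (by omega)] at h
          exact u_ne2 i h
        · exact not_adj_v i d (by omega) (by omega) hij
  have hback : ∀ i d, d < k → v (i + d + (k - d)) = v i := fun i d h =>
    (v_eq_iff _ _).2 (by rw [show i + d + (k - d) = i + k by omega]; simp)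
  refine ⟨k, v, u, hk5, v_eq_iff, adj, adj_u, u_ne_v, ?_, not_adj_v, ?_, ?_⟩
  · intro i j
    refine ⟨fun h => ?_, fun h => by rw [hu, hu, h]⟩
    by_contra hne
    obtain ⟨d, hd, hdk, he⟩ := exists_eq_add_of_mod_ne hk0 hne
    have hj := adj_u j
    rw [← h, ← (v_eq_iff _ _).2 he] at hj
    have h1 := one_extra i d (u i) hd hdk (u_ne_v i) (adj_u i) hj
    have h2 := one_extra (i + d) (k - d) (u i) (by omega) (by omega) (u_ne_v i) hj
      (by rw [hback i d hdk]; exact adj_u i)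
    omega
  · intro i d hd hdk h
    have h1 := two_extra i d _ _ hd hdk (u_ne_v i) (u_ne_v _) (adj_u i) (adj_u _) h
    have h2 := two_extra (i + d) (k - d) _ _ (by omega) (by omega) (u_ne_v _) (u_ne_v i) (adj_u _)
      (by rw [hback i d hdk]; exact adj_u i) h.symm
    omega
  · intro i w hw
    by_contra! hne
    have hle := hG.degree_le (v i)
    have hne12 : v (i + 1) ≠ v (i + k - 1) := by
      intro h
      rw [Nat.add_sub_assoc (by omega)] at h
      have := arc_inj i 1 (k - 1) (by omega) (by omega) h
      omega
    have : #({w, v (i + 1), v (i + k - 1), u i} : Finset V) ≤ G.degree (v i) := by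
      rw [← G.card_neighborFinset_eq_degree]
      apply card_le_card
      intro z hz
      simp only [mem_insert, mem_singleton] at hz
      rw [G.mem_neighborFinset]
      rcases hz with rfl | rfl | rfl | rfl
      · exact hw
      · exact adj i
      · exact hlast i
      · exact adj_u i
    rw [card_insert_of_notMem (by simpa using hne), card_insert_of_notMem
      (by simpa using ⟨hne12, (u_ne1 i).symm⟩), card_insert_of_notMem
      (by simpa using (u_ne2 i).symm), card_singleton] at this
    omega

end

section

variable {V : Type*} {G : SimpleGraph V} {k : ℕ} {v u : ℕ → V}

theorem IsShortestCycle.injOn_append (hC : IsShortestCycle G k v u) :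
    Set.InjOn (fun i => if i < k then v i else u (i - k)) (Set.Iio (2 * k)) := by
  intro i hi j hj h
  simp only [Set.mem_Iio] at hi hj
  simp only at h
  split_ifs at h
  · rw [hC.v_eq_iff, Nat.mod_eq_of_lt ‹_›, Nat.mod_eq_of_lt ‹_›] at h
    exact h
  · exact absurd h.symm (hC.u_ne_v _ _)
  · exact absurd h (hC.u_ne_v _ _)
  · rw [hC.u_eq_iff, Nat.mod_eq_of_lt (by omega), Nat.mod_eq_of_lt (by omega)] at h
    omega

theorem IsShortestCycle.adj_last (hC : IsShortestCycle G (k + 1) v u) : G.Adj (v k) (v 0) := by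
  have := hC.adj k
  rwa [(hC.v_eq_iff (k + 1) 0).2 (by simp)] at this

theorem IsShortestCycle.not_adj_u (hC : IsShortestCycle G k v u) (i d : ℕ) {j : ℕ} (hd : 0 < d)
    (hdk : d < k) (hj : j % k = (i + d) % k) (h : k > d + 3 ∨ d > 3) : ¬ G.Adj (u i) (u j) := by
  intro hadj
  rw [(hC.u_eq_iff _ _).2 hj] at hadj
  have := hC.of_adj_u i d hd hdk hadj
  omega

variable [Fintype V] [DecidableEq V] [DecidableRel G.Adj] {L : Sym2 V → Finset ℕ}

theorem IsCritical.not_isShortestCycle_five (hG : IsCritical G L) :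
    ¬ IsShortestCycle G 5 v u := by
  intro hC
  apply hG.false_of_reducibleFamily (N := 10)
    (E := [(0, 5), (0, 1), (1, 6), (1, 2), (2, 7), (2, 3), (3, 8), (3, 4), (4, 9), (4, 0)])
    (X := [0, 1, 2, 3, 4]) (opt := [(5, 7), (6, 8), (7, 9), (8, 5), (9, 6)])
    (non := [(5, 6), (6, 7), (7, 8), (8, 9), (9, 5)])
    (certs := [147425809235, 18576790611, 14298600276, 18325132372, 18576855891,
      18576856147, 14298665812, 18325197908, 14298600531, 78723110227, 74444919892,
      10020410708, 14298666067, 14298666323, 10020475988, 10020476244, 14282871636,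
      18309403732, 10004681557, 14031213653, 14282937172, 18309469268, 10004747093,
      14031279189, 14282871892, 14282872148, 5726491733, 5726491989, 14282937428,
      14282937684, 5726557269, 5726557525]) (by decide +kernel) hC.injOn_append
  · simp [hC.adj, hC.adj_u, hC.adj_last]
  · have h := hC.not_adj_u
    simp [h 0 1 (j := 1), h 1 1 (j := 2), h 2 1 (j := 3), h 3 1 (j := 4), h 4 1 (j := 0)]

theorem IsCritical.not_isShortestCycle_six (hG : IsCritical G L) :
    ¬ IsShortestCycle G 6 v u := by
  intro hC
  apply hG.false_of_reducibleFamily (N := 12)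
    (E := [(0, 6), (0, 1), (1, 7), (1, 2), (2, 8), (2, 3), (3, 9), (3, 4), (4, 10), (4, 5),
      (5, 11), (5, 0)])
    (X := [0, 1, 2, 3, 4, 5]) (opt := [(6, 9), (7, 10), (8, 11)])
    (non := [(6, 7), (7, 8), (8, 9), (9, 10), (10, 11), (11, 6), (6, 8), (7, 9), (8, 10),
      (9, 11), (10, 6), (11, 7)])
    (certs := [37672555074387, 37672555139923, 36577338414163, 3591989646419, 20080385807188,
      3587711456084, 2492494730324, 2492494795860]) (by decide +kernel) hC.injOn_append
  · simp [hC.adj, hC.adj_u, hC.adj_last]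
  · have h := hC.not_adj_u
    simp [h 0 1 (j := 1), h 1 1 (j := 2), h 2 1 (j := 3), h 3 1 (j := 4), h 4 1 (j := 5),
      h 5 1 (j := 0), h 0 2 (j := 2), h 1 2 (j := 3), h 2 2 (j := 4), h 3 2 (j := 5),
      h 4 2 (j := 0), h 5 2 (j := 1)]

end

theorem overwrite_eq {ρ a f : ℕ → ℕ} (hρ : Set.InjOn ρ (Set.Iio 18)) {k : ℕ}
    (hf : ∀ t < 18, digit k t = f (ρ t)) (ha : ∀ w, (∀ t < 18, ρ t ≠ w) → a w = f w) :
    overwrite ρ a k = f := by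
  funext w
  by_cases hw : ∃ t < 18, ρ t = w
  · obtain ⟨t, ht, rfl⟩ := hw
    rw [overwrite_apply hρ ht, hf t ht]
  · rw [overwrite, dif_neg hw]
    push Not at hw
    exact ha w hw

/-- The conflicts between two consecutive labels `0`, `1` of a band and the next four. -/
def stepEdges : List (ℕ × ℕ) := [(0, 1), (0, 2), (0, 3), (1, 2), (1, 3), (1, 4), (1, 5)]

/-- The top six labels of a band with `2 * j + 10` labels, in decreasing order, followed by
unused labels. -/
def stepLabel (j t : ℕ) : ℕ := if t < 6 then 2 * j + 9 - t else 2 * j + 8 + t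

/-- The conflicts among the first `2 * j + 8` edges at a long cycle. -/
def bandEdges : ℕ → List (ℕ × ℕ)
  | 0 => [(1, 0), (2, 0), (2, 1), (3, 0), (3, 1), (3, 2), (4, 0), (4, 1), (4, 2), (4, 3), (5, 2),
      (5, 3), (5, 4), (6, 2), (6, 3), (6, 4), (6, 5), (7, 4), (7, 5), (7, 6)]
  | j + 1 => stepEdges.map (Prod.map (stepLabel j) (stepLabel j)) ++ bandEdges j

/-- The exponents on a band of `2 * j + 8` labels. -/
def bandExponent (j w : ℕ) : ℕ :=
  if w < 4 then digit 4867 w else if w < 2 * j + 8 then 4 - w % 2 else 0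

/-- The sum of the two coefficients of `bandEdges j` at the exponents obtained from
`bandExponent j` by lowering one of the last two by one. -/
noncomputable def bandCoeff (j : ℕ) : ℤ :=
  edgeCoeff (bandEdges j) (Function.update (bandExponent j) (2 * j + 6) 3) +
    edgeCoeff (bandEdges j) (Function.update (bandExponent j) (2 * j + 7) 2)

theorem lt_of_mem_bandEdges {j : ℕ} :
    ∀ {p : ℕ × ℕ}, p ∈ bandEdges j → p.1 < 2 * j + 8 ∧ p.2 < 2 * j + 8 := by
  induction j with
  | zero =>
    intro p hp
    simp only [bandEdges, List.mem_cons, List.not_mem_nil, or_false] at hp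
    rcases hp with rfl | rfl | rfl | rfl | rfl | rfl | rfl | rfl | rfl | rfl | rfl | rfl | rfl |
      rfl | rfl | rfl | rfl | rfl | rfl | rfl <;> simp
  | succ j ih =>
    intro p hp
    rw [bandEdges, List.mem_append] at hp
    rcases hp with hp | hp
    · simp only [stepEdges, List.map_cons, List.map_nil, List.mem_cons, List.not_mem_nil,
        or_false, Prod.map, stepLabel] at hp
      rcases hp with rfl | rfl | rfl | rfl | rfl | rfl | rfl <;> simp <;> omega
    · have := ih hp
      omega

theorem occ_bandEdges {j w : ℕ} (hw : 2 * j + 8 ≤ w) : occ w (bandEdges j) = 0 := by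
  rw [occ, List.countP_eq_zero]
  intro p hp
  have := lt_of_mem_bandEdges hp
  simp only [Bool.or_eq_true, beq_iff_eq]
  omega

theorem mem_bandEdges {j : ℕ} : ∀ {i l : ℕ}, l < i → i < 2 * j + 8 → i ≤ l + (4 - i % 2) →
    (i, l) ∈ bandEdges j := by
  induction j with
  | zero =>
    intro i l hl hi h
    simp only [Nat.mul_zero, Nat.zero_add] at hi
    interval_cases i <;> interval_cases l <;> simp_all [bandEdges]
  | succ j ih =>
    intro i l hl hi h
    rw [bandEdges, List.mem_append]
    by_cases hlt : i < 2 * j + 8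
    · exact Or.inr (ih hl hlt h)
    · left
      simp only [stepEdges, List.map_cons, List.map_nil, List.mem_cons, List.not_mem_nil,
        or_false, Prod.map, stepLabel, Prod.mk.injEq]
      simp
      omega

theorem injOn_stepLabel (j : ℕ) : Set.InjOn (stepLabel j) (Set.Iio 18) := by
  intro p hp q hq h
  simp only [stepLabel, Set.mem_Iio] at h hp hq
  split_ifs at h <;> omega

theorem bandCoeff_succ (j : ℕ) : bandCoeff (j + 1) = -bandCoeff j := by
  have hinj := injOn_stepLabel j
  have hexp := termsValue_expandTerms (a := bandExponent j) hinj
    (closed := fun t => Nat.blt t 2) (E := stepEdges) (E' := bandEdges j) (by decide)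
    (fun w _ hw => occ_bandEdges (by
      rw [Nat.blt_eq] at hw
      simp only [stepLabel]
      split_ifs <;> omega)) [(4408115, 1), (4408130, 1)]
  have hval : expandTerms (fun t => Nat.blt t 2) stepEdges [(4408115, 1), (4408130, 1)] =
      [(4403968, -1), (4407808, -1)] := by decide +kernel
  rw [hval] at hexp
  have ha : ∀ x c w, (x = 2 * j + 8 ∨ x = 2 * j + 9) → (∀ t < 18, stepLabel j t ≠ w) →
      bandExponent j w = Function.update (bandExponent (j + 1)) x c w := by
    intro x c w hx hw
    have h0 := hw 0 (by norm_num)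
    have h1 := hw 1 (by norm_num)
    simp only [stepLabel, Nat.reduceLT, if_true] at h0 h1
    rw [Function.update_of_ne (by omega)]
    simp only [bandExponent]
    split_ifs <;> omega
  have ha' : ∀ x c w, (x = 2 * j + 6 ∨ x = 2 * j + 7) → (∀ t < 18, stepLabel j t ≠ w) →
      bandExponent j w = Function.update (bandExponent j) x c w := by
    intro x c w hx hw
    have h0 := hw 2 (by norm_num)
    have h1 := hw 3 (by norm_num)
    simp only [stepLabel, Nat.reduceLT, if_true] at h0 h1
    rw [Function.update_of_ne (by omega)]
  have e1 := overwrite_eq (k := 4408115) hinj (fun t ht => ?_) (ha (2 * j + 8) 3 · (Or.inl rfl))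
  have e2 := overwrite_eq (k := 4408130) hinj (fun t ht => ?_) (ha (2 * j + 9) 2 · (Or.inr rfl))
  have e3 := overwrite_eq (k := 4403968) hinj (fun t ht => ?_) (ha' (2 * j + 6) 3 · (Or.inl rfl))
  have e4 := overwrite_eq (k := 4407808) hinj (fun t ht => ?_) (ha' (2 * j + 7) 2 · (Or.inr rfl))
  · simp only [termsValue, List.map_cons, List.map_nil, List.sum_cons, List.sum_nil, e1, e2, e3,
      e4] at hexp
    simp only [bandCoeff, bandEdges, Nat.mul_add, Nat.add_assoc, Nat.mul_one, Nat.reduceAdd] at *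
    linarith
  all_goals
    interval_cases t <;> simp [digit, stepLabel, bandExponent, Function.update_apply] <;>
      (try split_ifs) <;> omega

theorem bandCoeff_ne_zero (j : ℕ) : bandCoeff j ≠ 0 := by
  induction j with
  | zero =>
    have hid : Set.InjOn id (Set.Iio 18) := Function.injective_id.injOn
    have hexp := termsValue_expandTerms (a := 0) hid (closed := fun _ => true)
      (E := bandEdges 0) (E' := []) (by decide) (by simp [occ]) [(607392515, 1), (859050755, 1)]
    have hval : expandTerms (fun _ => true) (bandEdges 0) [(607392515, 1), (859050755, 1)] =
        [(0, 1)] := by decide +kernel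
    have hmap : (bandEdges 0).map (Prod.map id id) ++ [] = bandEdges 0 := by simp
    have ha : ∀ x c w, x < 8 → (∀ t < 18, id t ≠ w) →
        (0 : ℕ → ℕ) w = Function.update (bandExponent 0) x c w := by
      intro x c w hx hw
      have h18 : 18 ≤ w := by
        by_contra h
        exact hw w (by omega) rfl
      rw [Function.update_of_ne (by omega)]
      simp only [bandExponent, Pi.zero_apply]
      split_ifs <;> omega
    rw [hval, hmap] at hexp
    have e1 := overwrite_eq (k := 607392515) hid (fun t ht => ?_) (ha 7 2 · (by omega))
    have e2 := overwrite_eq (k := 859050755) hid (fun t ht => ?_) (ha 6 3 · (by omega))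
    have e3 : overwrite id 0 0 = 0 := overwrite_eq hid (by simp [digit]) (by simp)
    · simp only [termsValue, List.map_cons, List.map_nil, List.sum_cons, List.sum_nil, e1, e2,
        e3] at hexp
      simp only [edgeCoeff, if_true] at hexp
      simp only [bandCoeff, Nat.mul_zero, Nat.zero_add]
      omega
    all_goals
      interval_cases t <;> simp [digit, bandExponent]
  | succ j ih =>
    rw [bandCoeff_succ]
    exact neg_ne_zero.2 ih

/-- The conflicts involving the last ten of the edges at a long cycle, in terms of `blockLabel`. -/
def blockEdges : List (ℕ × ℕ) :=
  (List.range 10).flatMap fun s =>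
    (((List.range 14).filter fun t => Nat.blt s t && Nat.ble t (s + 3 + s % 2)).map fun t =>
      (s, t)) ++
    ((List.range 4).filter fun l => Nat.ble (l + s + 1) (4 - l % 2)).map fun l => (l + 14, s)

/-- The last fourteen of `2 * j + 18` labels in decreasing order, followed by the first four. -/
def blockLabel (j t : ℕ) : ℕ := if t < 14 then 2 * j + 17 - t else t - 14

theorem injOn_blockLabel (j : ℕ) : Set.InjOn (blockLabel j) (Set.Iio 18) := by
  intro p hp q hq h
  simp only [blockLabel, Set.mem_Iio] at h hp hq
  split_ifs at h <;> omega

theorem edgeCoeff_blockEdges_append_bandEdges_ne_zero (j : ℕ) :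
    edgeCoeff (blockEdges.map (Prod.map (blockLabel j) (blockLabel j)) ++ bandEdges j)
      (overwrite (blockLabel j) (bandExponent j) 389922574119106466643) ≠ 0 := by
  have hinj := injOn_blockLabel j
  have hexp := termsValue_expandTerms (a := bandExponent j) hinj
    (closed := fun t => Nat.blt t 10) (E := blockEdges) (E' := bandEdges j) (by decide)
    (fun w _ hw => occ_bandEdges (by
      rw [Nat.blt_eq] at hw
      simp only [blockLabel]
      split_ifs <;> omega)) [(389922574119106466643, 1)]
  have hval : expandTerms (fun t => Nat.blt t 10) blockEdges [(389922574119106466643, 1)] =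
      [(350723225081127895040, -1), (350723241573802311680, -1)] := by decide +kernel
  rw [hval] at hexp
  have ha : ∀ x c w, (x = 2 * j + 6 ∨ x = 2 * j + 7) → (∀ t < 18, blockLabel j t ≠ w) →
      bandExponent j w = Function.update (bandExponent j) x c w := by
    intro x c w hx hw
    have h0 := hw 10 (by norm_num)
    have h1 := hw 11 (by norm_num)
    simp only [blockLabel, Nat.reduceLT, if_true] at h0 h1
    rw [Function.update_of_ne (by omega)]
  have e1 := overwrite_eq (k := 350723225081127895040) hinj (fun t ht => ?_)
    (ha (2 * j + 6) 3 · (Or.inl rfl))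
  have e2 := overwrite_eq (k := 350723241573802311680) hinj (fun t ht => ?_)
    (ha (2 * j + 7) 2 · (Or.inr rfl))
  · simp only [termsValue, List.map_cons, List.map_nil, List.sum_cons, List.sum_nil, e1, e2,
      one_mul, add_zero] at hexp
    rw [← hexp]
    have := bandCoeff_ne_zero j
    simp only [bandCoeff] at this
    intro h
    apply this
    linarith
  all_goals
    interval_cases t <;> simp [digit, blockLabel, bandExponent, Function.update_apply]

/-- The conflicts between `n` labels arranged in a ring. -/
def ringEdges (n : ℕ) : List (ℕ × ℕ) :=
  (List.range n).flatMap fun i => ((List.range i).filter fun l =>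
    Nat.ble i (l + (4 - i % 2)) || Nat.ble (l + n) (i + (4 - l % 2))).map fun l => (i, l)

theorem exists_edgeCoeff_ring_ne_zero {k : ℕ} (hk : 7 ≤ k) : ∃ (E : List (ℕ × ℕ)) (b : ℕ → ℕ),
    edgeCoeff E b ≠ 0 ∧ (∀ i < 2 * k, b i + 2 * (i % 2) ≤ 5) ∧
    ∀ l i, l < i → i < 2 * k → (i ≤ l + (4 - i % 2) ∨ l + 2 * k ≤ i + (4 - l % 2)) →
      (i, l) ∈ E ∨ (l, i) ∈ E := by
  have hsmall : ∀ n c, certifies (ringEdges n) c →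
      ((List.range n).all fun i => Nat.blt i 18 && Nat.ble (digit c i + 2 * (i % 2)) 5) →
      ∃ (E : List (ℕ × ℕ)) (b : ℕ → ℕ), edgeCoeff E b ≠ 0 ∧ (∀ i < n, b i + 2 * (i % 2) ≤ 5) ∧
      ∀ l i, l < i → i < n → (i ≤ l + (4 - i % 2) ∨ l + n ≤ i + (4 - l % 2)) →
        (i, l) ∈ E ∨ (l, i) ∈ E := by
    intro n c hc hb
    refine ⟨_, _, edgeCoeff_ne_zero_of_certifies hc, fun i hi => ?_, fun l i hl hi h => ?_⟩
    · rw [List.all_eq_true] at hb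
      have := hb i (List.mem_range.2 hi)
      rw [Bool.and_eq_true, Nat.blt_eq, Nat.ble_eq] at this
      rw [show overwrite id 0 c i = digit c i from
        overwrite_apply Function.injective_id.injOn this.1]
      exact this.2
    · left
      simp only [ringEdges, List.mem_flatMap, List.mem_range, List.mem_map, List.mem_filter,
        Bool.or_eq_true, Nat.ble_eq]
      exact ⟨i, hi, l, ⟨hl, h⟩, rfl⟩
  by_cases h7 : k = 7
  · subst h7
    exact hsmall 14 14976672112842019 (by decide +kernel) (by decide)
  by_cases h8 : k = 8
  · subst h8
    exact hsmall 16 3834028060889584931 (by decide +kernel) (by decide)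
  obtain ⟨j, rfl⟩ : ∃ j, k = j + 9 := ⟨k - 9, by omega⟩
  refine ⟨_, _, edgeCoeff_blockEdges_append_bandEdges_ne_zero j, fun i hi => ?_,
    fun l i hl hi h => ?_⟩
  · by_cases h : ∃ t < 18, blockLabel j t = i
    · obtain ⟨t, ht, rfl⟩ := h
      rw [overwrite_apply (injOn_blockLabel j) ht]
      interval_cases t <;> simp [digit, blockLabel]
    · rw [overwrite, dif_neg h]
      have h4 : 4 ≤ i := by
        by_contra hlt
        exact h ⟨i + 14, by omega, by simp [blockLabel]⟩
      simp only [bandExponent]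
      split_ifs <;> omega
  · by_cases hi' : i < 2 * j + 8
    · left
      rw [List.mem_append]
      exact Or.inr (mem_bandEdges hl hi' (by omega))
    · have hmem : ∀ s t, (s, t) ∈ blockEdges → (blockLabel j s, blockLabel j t) ∈
          blockEdges.map (Prod.map (blockLabel j) (blockLabel j)) ++ bandEdges j :=
        fun s t hst => List.mem_append_left _ (List.mem_map.2 ⟨_, hst, rfl⟩)
      have hi'' : i = blockLabel j (2 * j + 17 - i) := by
        simp only [blockLabel]
        split_ifs <;> omega
      by_cases hd : i ≤ l + (4 - i % 2)
      · left
        have hl' : l = blockLabel j (2 * j + 17 - l) := by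
          simp only [blockLabel]
          split_ifs <;> omega
        rw [hi'', hl']
        apply hmem
        simp only [blockEdges, List.mem_flatMap, List.mem_range, List.mem_append, List.mem_map,
          List.mem_filter, Bool.and_eq_true, Nat.ble_eq, Nat.blt_eq]
        exact ⟨2 * j + 17 - i, by omega, Or.inl ⟨2 * j + 17 - l, by omega, rfl⟩⟩
      · right
        have hl' : l = blockLabel j (l + 14) := by
          simp [blockLabel]
        rw [hi'', hl']
        apply hmem
        simp only [blockEdges, List.mem_flatMap, List.mem_range, List.mem_append, List.mem_map,
          List.mem_filter, Nat.ble_eq]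
        exact ⟨2 * j + 17 - i, by omega, Or.inr ⟨l, by omega, rfl⟩⟩

section

variable {V : Type*} {G : SimpleGraph V} {k : ℕ} {v u : ℕ → V}

theorem eq_or_eq_add_of_mod_eq {x y : ℕ} (h : x % k = y % k) (hx : x < y + 2 * k)
    (hy : y < x + 2 * k) : x = y ∨ x = y + k ∨ y = x + k := by
  have h1 := Nat.div_add_mod x k
  have h2 := Nat.div_add_mod y k
  rw [h] at h1
  have h3 : x / k < y / k + 2 := by
    by_contra hc
    have := Nat.mul_le_mul_left k (not_lt.1 hc)
    rw [mul_add] at this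
    omega
  have h4 : y / k < x / k + 2 := by
    by_contra hc
    have := Nat.mul_le_mul_left k (not_lt.1 hc)
    rw [mul_add] at this
    omega
  have h5 : x / k = y / k ∨ x / k = y / k + 1 ∨ y / k = x / k + 1 := by omega
  rcases h5 with h5 | h5 | h5
  · rw [h5] at h1
    omega
  · rw [h5, mul_add] at h1
    omega
  · rw [h5, mul_add] at h2
    omega

theorem edgeConflict.exists_mem {e f : Sym2 V} (h : edgeConflict G e f) :
    ∃ z ∈ e, ∃ w ∈ f, z = w ∨ G.Adj z w := by
  obtain ⟨-, ⟨z, h1, h2⟩ | ⟨g, hg, ⟨z, h1, h2⟩, ⟨w, h3, h4⟩⟩⟩ := h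
  · exact ⟨z, h1, z, h2, Or.inl rfl⟩
  · refine ⟨z, h1, w, h4, ?_⟩
    by_cases hzw : z = w
    · exact Or.inl hzw
    · right
      rwa [(Sym2.mem_and_mem_iff hzw).1 ⟨h2, h3⟩, SimpleGraph.mem_edgeSet] at hg

/-- The endpoint other than `v (i / 2)` of the `i`-th edge at a shortest cycle. -/
def cycleEnd (k : ℕ) (v u : ℕ → V) (i : ℕ) : V :=
  if i % 2 = 1 then u (i / 2) else v (i / 2 + k - 1)

theorem IsShortestCycle.mod_of_adj (hC : IsShortestCycle G k v u) {c d : ℕ}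
    (h : v c = v d ∨ G.Adj (v c) (v d)) :
    c % k = d % k ∨ (c + 1) % k = d % k ∨ c % k = (d + 1) % k := by
  have h5 := hC.five_le
  rcases h with h | h
  · exact Or.inl ((hC.v_eq_iff _ _).1 h)
  · rcases hC.eq_of_adj _ _ h with h | h | h
    · exact Or.inr (Or.inl ((hC.v_eq_iff _ _).1 h).symm)
    · refine Or.inr (Or.inr ?_)
      have := (hC.v_eq_iff _ _).1 h
      rw [Nat.add_mod, this, ← Nat.add_mod, show c + k - 1 + 1 = c + k by omega, Nat.add_mod_right]
    · exact absurd h.symm (hC.u_ne_v _ _)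

theorem IsShortestCycle.mod_of_adj_u (hC : IsShortestCycle G k v u) {c d : ℕ}
    (h : v c = u d ∨ G.Adj (v c) (u d)) : c % k = d % k := by
  rcases h with h | h
  · exact absurd h.symm (hC.u_ne_v _ _)
  · rcases hC.eq_of_adj _ _ h with h | h | h
    · exact absurd h (hC.u_ne_v _ _)
    · exact absurd h (hC.u_ne_v _ _)
    · exact ((hC.u_eq_iff _ _).1 h).symm

theorem IsShortestCycle.mod_of_u_adj_u (hC : IsShortestCycle G k v u) (hk : 7 ≤ k) {c d : ℕ}
    (h : u c = u d ∨ G.Adj (u c) (u d)) : c % k = d % k := by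
  rcases h with h | h
  · exact (hC.u_eq_iff _ _).1 h
  · by_contra hne
    obtain ⟨t, ht, htk, he⟩ := exists_eq_add_of_mod_ne (by omega) hne
    exact hC.not_adj_u c t ht htk he.symm (by omega) h

theorem IsShortestCycle.mod_of_conflict (hC : IsShortestCycle G k v u) (hk : 7 ≤ k) {i l : ℕ}
    (h : edgeConflict G s(v (i / 2), cycleEnd k v u i) s(v (l / 2), cycleEnd k v u l)) :
    ∃ c d, (c = i / 2 ∨ i % 2 = 0 ∧ c = i / 2 + k - 1) ∧
      (d = l / 2 ∨ l % 2 = 0 ∧ d = l / 2 + k - 1) ∧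
      (c % k = d % k ∨ (c + 1) % k = d % k ∨ c % k = (d + 1) % k) := by
  have hmem : ∀ i z, z ∈ s(v (i / 2), cycleEnd k v u i) →
      (∃ c, (c = i / 2 ∨ i % 2 = 0 ∧ c = i / 2 + k - 1) ∧ z = v c) ∨ z = u (i / 2) := by
    intro i z hz
    rw [Sym2.mem_iff, cycleEnd] at hz
    split_ifs at hz with hi
    · rcases hz with rfl | rfl
      · exact Or.inl ⟨_, Or.inl rfl, rfl⟩
      · exact Or.inr rfl
    · rcases hz with rfl | rfl
      · exact Or.inl ⟨_, Or.inl rfl, rfl⟩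
      · exact Or.inl ⟨_, Or.inr ⟨by omega, rfl⟩, rfl⟩
  obtain ⟨z, hz, w, hw, hzw⟩ := h.exists_mem
  rcases hmem i z hz with ⟨c, hc, rfl⟩ | rfl <;> rcases hmem l w hw with ⟨d, hd, rfl⟩ | rfl
  · exact ⟨c, d, hc, hd, hC.mod_of_adj hzw⟩
  · exact ⟨c, _, hc, Or.inl rfl, Or.inl (hC.mod_of_adj_u hzw)⟩
  · refine ⟨_, d, Or.inl rfl, hd, Or.inl (hC.mod_of_adj_u ?_).symm⟩
    exact hzw.imp Eq.symm SimpleGraph.Adj.symm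
  · exact ⟨_, _, Or.inl rfl, Or.inl rfl, Or.inl (hC.mod_of_u_adj_u hk hzw)⟩

theorem IsShortestCycle.near_of_conflict (hC : IsShortestCycle G k v u) (hk : 7 ≤ k) {i l : ℕ}
    (hl : l < i) (hi : i < 2 * k)
    (h : edgeConflict G s(v (i / 2), cycleEnd k v u i) s(v (l / 2), cycleEnd k v u l)) :
    i ≤ l + (4 - i % 2) ∨ l + 2 * k ≤ i + (4 - l % 2) := by
  obtain ⟨c, d, hc, hd, h⟩ := hC.mod_of_conflict hk h
  rcases h with h | h | h <;>
    have h := eq_or_eq_add_of_mod_eq h (by omega) (by omega) <;> omega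

open Finset

variable [DecidableEq V]

theorem IsShortestCycle.v_mem (hC : IsShortestCycle G k v u) (i : ℕ) :
    v i ∈ (range k).image v := by
  have := hC.five_le
  exact mem_image.2 ⟨i % k, mem_range.2 (Nat.mod_lt _ (by omega)), (hC.v_eq_iff _ _).2 (by simp)⟩

variable [Fintype V] [DecidableRel G.Adj] {L : Sym2 V → Finset ℕ}

theorem IsShortestCycle.outerDegree_u_le (hC : IsShortestCycle G k v u) (i : ℕ) :
    outerDegree G ((range k).image v) (u i) ≤ 2 := by
  unfold outerDegree
  split_ifs
  · omega
  · have : 0 < #(G.neighborFinset (u i) ∩ (range k).image v) :=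
      card_pos.2 ⟨v i, mem_inter.2 ⟨by simpa using (hC.adj_u i).symm, hC.v_mem i⟩⟩
    omega

theorem IsShortestCycle.sum_outerDegree_le (hC : IsShortestCycle G k v u) (i : ℕ) (w : V) :
    ∑ z ∈ (G.neighborFinset (v i)).erase w, outerDegree G ((range k).image v) z ≤
      if w = u i then 0 else 2 := by
  have hz : ∀ z ∈ (G.neighborFinset (v i)).erase w,
      outerDegree G ((range k).image v) z ≠ 0 → z ∈ ({u i} : Finset V).erase w := by
    intro z hz h0
    rw [mem_erase, G.mem_neighborFinset] at hz
    rw [mem_erase, mem_singleton]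
    refine ⟨hz.1, ?_⟩
    rcases hC.eq_of_adj i z hz.2 with rfl | rfl | h
    · exact absurd (if_pos (hC.v_mem _)) h0
    · exact absurd (if_pos (hC.v_mem _)) h0
    · exact h
  refine (sum_le_sum_of_ne_zero hz).trans ?_
  split_ifs with hw
  · simp [hw]
  · refine (sum_le_sum_of_subset (erase_subset _ _)).trans ?_
    rw [sum_singleton]
    exact hC.outerDegree_u_le i

theorem IsCritical.outerConflicts_le (hG : IsCritical G L) (hC : IsShortestCycle G k v u)
    (i : ℕ) : outerConflicts G ((range k).image v) (v (i / 2)) (cycleEnd k v u i) ≤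
      4 + 2 * (i % 2) := by
  have h5 := hC.five_le
  unfold outerConflicts
  by_cases hi : i % 2 = 1
  · rw [show cycleEnd k v u i = u (i / 2) from if_pos hi]
    have h1 := hC.sum_outerDegree_le (i / 2) (u (i / 2))
    rw [if_pos rfl] at h1
    have h2 : ∑ z ∈ (G.neighborFinset (u (i / 2))).erase (v (i / 2)),
        outerDegree G ((range k).image v) z ≤ 2 * 3 := by
      refine (sum_le_card_nsmul _ _ 3 fun z _ => ?_).trans ?_
      · unfold outerDegree
        split_ifs <;> omega
      · rw [smul_eq_mul, card_erase_of_mem (by simpa using (hC.adj_u _).symm),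
          G.card_neighborFinset_eq_degree]
        have := hG.degree_le (u (i / 2))
        omega
    omega
  · rw [show cycleEnd k v u i = v (i / 2 + k - 1) from if_neg hi]
    have h1 := hC.sum_outerDegree_le (i / 2) (v (i / 2 + k - 1))
    have h2 := hC.sum_outerDegree_le (i / 2 + k - 1) (v (i / 2))
    rw [if_neg (hC.u_ne_v _ _).symm] at h1 h2
    omega

theorem IsCritical.not_isShortestCycle_of_seven_le (hG : IsCritical G L) (hk : 7 ≤ k) :
    ¬ IsShortestCycle G k v u := by
  intro hC
  have hlast : ∀ i, v (i + 1 + k - 1) = v i := fun i =>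
    (hC.v_eq_iff _ _).2 (by rw [show i + 1 + k - 1 = i + k by omega]; simp)
  obtain ⟨E, b, hc, hb, hE⟩ := exists_edgeCoeff_ring_ne_zero hk
  refine hG.not_colorable (exists_coloring_of_edgeCoeff_ne_zero hG.degree_le hG.card_le
    hG.exists_coloring (X := (range k).image v) (m := 2 * k) (by omega)
    (x := fun i => v (i / 2)) (y := cycleEnd k v u) (fun i _ => hC.v_mem _) ?_ ?_ hc ?_ ?_)
  · intro i _
    unfold cycleEnd
    split_ifs
    · exact hC.adj_u _
    · have := hC.adj (i / 2 + k - 1)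
      rw [show i / 2 + k - 1 + 1 = i / 2 + k by omega,
        (hC.v_eq_iff (i / 2 + k) (i / 2)).2 (by simp)] at this
      exact this.symm
  · intro z hz w hzw
    obtain ⟨j, hj, rfl⟩ := mem_image.1 hz
    rw [mem_range] at hj
    have e0 : 2 * j / 2 = j := by omega
    have e1 : (2 * j + 1) / 2 = j := by omega
    have e2 : (2 * j + 2) / 2 = j + 1 := by omega
    rcases hC.eq_of_adj j w hzw with rfl | rfl | rfl
    · by_cases hjk : j + 1 < k
      · refine ⟨2 * j + 2, by omega, ?_⟩
        simp only [cycleEnd, e2, hlast]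
        rw [if_neg (by omega), Sym2.eq_swap]
      · obtain rfl : k = j + 1 := by omega
        refine ⟨0, by omega, ?_⟩
        rw [(hC.v_eq_iff (j + 1) 0).2 (by simp), Sym2.eq_swap]
        simp [cycleEnd]
    · refine ⟨2 * j, by omega, ?_⟩
      simp only [cycleEnd, e0]
      rw [if_neg (by omega)]
    · refine ⟨2 * j + 1, by omega, ?_⟩
      simp only [cycleEnd, e1]
      rw [if_pos (by omega)]
  · intro i hi
    have h1 := hb i hi
    have h2 := hG.outerConflicts_le hC i
    omega
  · intro i hi l hl h
    rcases lt_trichotomy l i with hlt | rfl | hlt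
    · exact hE l i hlt hi (hC.near_of_conflict hk hlt hi h)
    · exact absurd rfl h.1
    · exact (hE i l hlt hl (hC.near_of_conflict hk hlt hl h.symm)).symm

theorem not_isCritical : ¬ IsCritical G L := by
  intro hG
  have hadj : ∃ a b, G.Adj a b := by
    by_contra! hno
    refine hG.not_colorable ⟨fun _ => 0, fun e he => ?_, fun e he => ?_⟩ <;>
      induction e with | _ a b => exact absurd he (hno a b)
  obtain ⟨a, b, hab⟩ := hadj
  obtain ⟨k, v, u, hC⟩ := hG.exists_isShortestCycle hab
  have h5 := hC.five_le
  by_cases hk5 : k = 5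
  · subst hk5
    exact hG.not_isShortestCycle_five hC
  by_cases hk6 : k = 6
  · subst hk6
    exact hG.not_isShortestCycle_six hC
  · exact hG.not_isShortestCycle_of_seven_le (by omega) hC

end

/-- If `G` is subcubic, `L` is a 10-edge list assignment, `G` has no strong `L`-edge-coloring
but every proper subgraph of `G` has one, then `G` is cubic. -/
theorem minimal_counterexample_is_cubic {V : Type*} [Fintype V] [DecidableEq V]
    (G : SimpleGraph V) [DecidableRel G.Adj] (hsub : ∀ v, G.degree v ≤ 3)
    (L : Sym2 V → Finset ℕ) (hL : ∀ e ∈ G.edgeSet, 10 ≤ (L e).card)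
    (hno : ¬ ∃ φ, IsStrongListColoring G L φ)
    (hmin : ∀ H : SimpleGraph V, H ≤ G → H ≠ G → ∃ φ, IsStrongListColoring H L φ) :
    ∀ v, G.degree v = 3 := by
  exact absurd ⟨hsub, hL, hno, hmin⟩ (not_isCritical (G := G) (L := L))
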